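/- Assume hypotheses (D), (M), (I), and fix ε∈[0,1/5]. The attainability sets of the ε-inflated differential inclusion define a set-valued process on C_γ: (i) Φ^ε(t₀,t₀,u₀)={u₀} for all u₀∈C_γ and t₀∈ℝ; (ii) Φ^ε(t₂,t₀,u₀) = ⋃_{w∈Φ^ε(t₁,t₀,u₀)} Φ^ε(t₂,t₁,w) for all t₀≤t₁≤t₂ and u₀∈C_γ; and (iii) Φ^ε(t₁,t₀,u₀) is a nonempty closed subset of C_γ for all t₁≥t₀ and u₀∈C_γ. -/

import Mathlib

open MeasureTheory Set Filter Topology Pointwise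

noncomputable section

/-- Index set for the synaptic variables `z i j`, `i ≠ j`. -/
abbrev IdxZ (n : ℕ) := {p : Fin n × Fin n // p.1 ≠ p.2}

/-- The state space `ℝ^{n²} = ℝ^n × ℝ^{n(n-1)}`, with the norm
`‖(x,z)‖ = max (‖x‖_∞) (‖z‖_∞)` (product of supremum norms). -/
abbrev NState (n : ℕ) := (Fin n → ℝ) × (IdxZ n → ℝ)

/-- The `C_γ` norm: `‖u‖_γ = sup_{t ≤ 0} e^{γ t} ‖u t‖`. -/
def gNorm (γ : ℝ) {E : Type*} [NormedAddCommGroup E] (u : ℝ → E) : ℝ :=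
  ⨆ t : Iic (0 : ℝ), Real.exp (γ * t.1) * ‖u t.1‖

/-- Membership in `C_γ`: continuity on `(-∞,0]`, existence of a finite limit of
`e^{γ t} u t` as `t → -∞`, and boundedness of `e^{γ t} ‖u t‖` on `(-∞,0]`. -/
def InC (γ : ℝ) {E : Type*} [NormedAddCommGroup E] [NormedSpace ℝ E] (u : ℝ → E) : Prop :=
  ContinuousOn u (Iic 0) ∧
    (∃ L : E, Tendsto (fun t => Real.exp (γ * t) • u t) atBot (𝓝 L)) ∧
    BddAbove (range fun t : Iic (0 : ℝ) => Real.exp (γ * t.1) * ‖u t.1‖)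

/-- The history `u_t(s) = u (t+s)`. -/
def hist {E : Type*} (u : ℝ → E) (t : ℝ) : ℝ → E := fun s => u (t + s)

/-- The sigmoidal function `σ_ε (s) = 1/(1+e^{-s/ε})`. -/
def sigm (ε s : ℝ) : ℝ := 1 / (1 + Real.exp (-s / ε))

/-- Hypothesis (D): `A i`, `B p` locally Lipschitz and bounded below by `α > 0`. -/
def HypD {n : ℕ} (α : ℝ) (A : Fin n → ℝ → ℝ) (B : IdxZ n → ℝ → ℝ) : Prop :=
  0 < α ∧ (∀ i, LocallyLipschitz (A i) ∧ ∀ s, α ≤ A i s) ∧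
    ∀ p, LocallyLipschitz (B p) ∧ ∀ s, α ≤ B p s

/-- Hypothesis (M): `∫_{-∞}^0 e^{-γ t} dμ_p (t) < ∞`. -/
def HypM {n : ℕ} (γ : ℝ) (μ : IdxZ n → Measure ℝ) : Prop :=
  ∀ p, ∫⁻ t in Iic (0 : ℝ), ENNReal.ofReal (Real.exp (-γ * t)) ∂(μ p) < ⊤

/-- Hypothesis (I): continuity of the external stimuli. -/
def HypI {n : ℕ} (Istim : Fin n → ℝ → ℝ) : Prop := ∀ i, Continuous (Istim i)

/-- Decay term `D`. -/
def decayT {n : ℕ} (A : Fin n → ℝ → ℝ) (B : IdxZ n → ℝ → ℝ) (u : ℝ → NState n) : NState n :=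
  (fun i => -(A i ((u 0).1 i)) * (u 0).1 i, fun p => -(B p ((u 0).2 p)) * (u 0).2 p)

/-- Sigmoidal excitation and inhibition term `Σ^ε`. -/
def sigTerm {n : ℕ} (ε : ℝ) (μ : IdxZ n → Measure ℝ) (c d : IdxZ n → ℝ)
    (Γ : Fin n → ℝ) (u : ℝ → NState n) : NState n :=
  (fun i => ∑ k : Fin n,
      if h : k ≠ i then
        ((u 0).2 ⟨(k, i), h⟩ - c ⟨(k, i), h⟩) *
          ∫ τ in Iic (0 : ℝ), sigm ε ((u τ).1 k - Γ k) ∂(μ ⟨(k, i), h⟩)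
      else 0,
    fun p =>
      d p * (∫ τ in Iic (0 : ℝ), sigm ε ((u τ).1 p.1.1 - Γ p.1.1) ∂(μ p)) *
        max ((u 0).1 p.1.2) 0)

/-- Stimulus term `I(t) = ((I_i(t))_i, 0)`. -/
def stimT {n : ℕ} (Istim : Fin n → ℝ → ℝ) (t : ℝ) : NState n :=
  (fun i => Istim i t, 0)

/-- Right-hand side `f_ε(t,u) = D(u) + Σ^ε(u) + I(t)` of the sigmoidal system. -/
def fEps {n : ℕ} (ε : ℝ) (A : Fin n → ℝ → ℝ) (B : IdxZ n → ℝ → ℝ)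
    (μ : IdxZ n → Measure ℝ) (c d : IdxZ n → ℝ) (Γ : Fin n → ℝ)
    (Istim : Fin n → ℝ → ℝ) (t : ℝ) (u : ℝ → NState n) : NState n :=
  decayT A B u + sigTerm ε μ c d Γ u + stimT Istim t

/-- Solution of the sigmoidal system on `[t₀, t₁)` with initial datum `u₀` at `t₀`. -/
def IsSigSolOn {n : ℕ} (ε : ℝ) (A : Fin n → ℝ → ℝ) (B : IdxZ n → ℝ → ℝ)
    (μ : IdxZ n → Measure ℝ) (c d : IdxZ n → ℝ) (Γ : Fin n → ℝ)
    (Istim : Fin n → ℝ → ℝ) (t₀ t₁ : ℝ) (u₀ u : ℝ → NState n) : Prop :=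
  (∀ s ≤ (0 : ℝ), u (t₀ + s) = u₀ s) ∧ ContinuousOn u (Iio t₁) ∧
    ∀ t ∈ Ico t₀ t₁, HasDerivAt u (fEps ε A B μ c d Γ Istim t (hist u t)) t

/-- Solution of the sigmoidal system on the closed interval `[t₀, t₁]`. -/
def IsSigSolOnC {n : ℕ} (ε : ℝ) (A : Fin n → ℝ → ℝ) (B : IdxZ n → ℝ → ℝ)
    (μ : IdxZ n → Measure ℝ) (c d : IdxZ n → ℝ) (Γ : Fin n → ℝ)
    (Istim : Fin n → ℝ → ℝ) (t₀ t₁ : ℝ) (u₀ u : ℝ → NState n) : Prop :=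
  (∀ s ≤ (0 : ℝ), u (t₀ + s) = u₀ s) ∧ ContinuousOn u (Iic t₁) ∧
    ∀ t ∈ Ico t₀ t₁, HasDerivAt u (fEps ε A B μ c d Γ Istim t (hist u t)) t

/-- `b(ε) = ε log((1-ε)/ε)` for `ε ≠ 0`, `b(0) = 0`. -/
def bfun (ε : ℝ) : ℝ := if ε = 0 then 0 else ε * Real.log ((1 - ε) / ε)

/-- The set-valued function `χ_ε`. -/
def chiSet (ε s : ℝ) : Set ℝ :=
  if s < -bfun ε then Icc 0 ε else if s ≤ bfun ε then Icc 0 1 else Icc (1 - ε) 1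

/-- Aumann integral over `(-∞,0]` of a set-valued map `F` with respect to `μ`:
the set of integrals of integrable measurable selectors of `F`. -/
def aumann (F : ℝ → Set ℝ) (μ : Measure ℝ) : Set ℝ :=
  {y | ∃ s : ℝ → ℝ, Measurable s ∧ IntegrableOn s (Iic 0) μ ∧
      (∀ t ≤ (0 : ℝ), s t ∈ F t) ∧ y = ∫ t in Iic (0 : ℝ), s t ∂μ}

/-- Directed Hausdorff pseudometric `haus(A,B) = sup_{a∈A} inf_{b∈B} |a-b|`. -/
def hausd (S T : Set ℝ) : ℝ :=
  sSup ((fun a => sInf ((fun b => |a - b|) '' T)) '' S)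

/-- The `i`-th factor of `X^ε(u)`: the Minkowski sum over `k ≠ i` of
`(z_{ki}(0) - c_{ki}) • ∫ χ_ε(x_k(τ)-Γ_k) dμ_{ki}(τ)`. -/
def XsetX {n : ℕ} (ε : ℝ) (μ : IdxZ n → Measure ℝ) (c : IdxZ n → ℝ)
    (Γ : Fin n → ℝ) (u : ℝ → NState n) (i : Fin n) : Set ℝ :=
  {y | ∃ g : Fin n → ℝ, g i = 0 ∧
      (∀ k, ∀ h : k ≠ i,
        g k ∈ ((u 0).2 ⟨(k, i), h⟩ - c ⟨(k, i), h⟩) •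
          aumann (fun τ => chiSet ε ((u τ).1 k - Γ k)) (μ ⟨(k, i), h⟩)) ∧
      y = ∑ k, g k}

/-- The set-valued map `X^ε : C_γ → 𝒫(ℝ^{n²})`. -/
def Xset {n : ℕ} (ε : ℝ) (μ : IdxZ n → Measure ℝ) (c d : IdxZ n → ℝ)
    (Γ : Fin n → ℝ) (u : ℝ → NState n) : Set (NState n) :=
  {v | (∀ i, v.1 i ∈ XsetX ε μ c Γ u i) ∧
      ∀ p : IdxZ n, v.2 p ∈ (d p * max ((u 0).1 p.1.2) 0) •
        aumann (fun τ => chiSet ε ((u τ).1 p.1.1 - Γ p.1.1)) (μ p)}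

/-- Solution of the `ε`-inflated differential inclusion on `[t₀,t₁]` with initial
datum `u₀` at `t₀`: absolutely continuous on `[t₀,t₁]` (expressed in integral form)
with `u'(t) = D(u_t) + Σ(t) + I(t)` a.e. for some integrable selector `Σ(t) ∈ X^ε(u_t)`. -/
def IsIncSolOn {n : ℕ} (ε : ℝ) (A : Fin n → ℝ → ℝ) (B : IdxZ n → ℝ → ℝ)
    (μ : IdxZ n → Measure ℝ) (c d : IdxZ n → ℝ) (Γ : Fin n → ℝ)
    (Istim : Fin n → ℝ → ℝ) (t₀ t₁ : ℝ) (u₀ u : ℝ → NState n) : Prop :=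
  (∀ s ≤ (0 : ℝ), u (t₀ + s) = u₀ s) ∧ ContinuousOn u (Icc t₀ t₁) ∧
    ∃ S : ℝ → NState n,
      (∀ t ∈ Icc t₀ t₁, S t ∈ Xset ε μ c d Γ (hist u t)) ∧
      IntegrableOn (fun s => decayT A B (hist u s) + S s + stimT Istim s) (Icc t₀ t₁) ∧
      ∀ t ∈ Icc t₀ t₁,
        u t = u₀ 0 + ∫ s in t₀..t, (decayT A B (hist u s) + S s + stimT Istim s)

/-- Clamped history: the canonical representative in `C_γ` of the history `u_t`. -/
def clampHist {n : ℕ} (u : ℝ → NState n) (t : ℝ) : ℝ → NState n :=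
  fun s => u (t + min s 0)

/-- Attainability set `Φ^ε(t, t₀, u₀)` of the `ε`-inflated inclusion. -/
def attain {n : ℕ} (ε : ℝ) (A : Fin n → ℝ → ℝ) (B : IdxZ n → ℝ → ℝ)
    (μ : IdxZ n → Measure ℝ) (c d : IdxZ n → ℝ) (Γ : Fin n → ℝ)
    (Istim : Fin n → ℝ → ℝ) (t t₀ : ℝ) (u₀ : ℝ → NState n) : Set (ℝ → NState n) :=
  {v | ∃ u, IsIncSolOn ε A B μ c d Γ Istim t₀ t u₀ u ∧ v = clampHist u t}

/-- Total mass `|μ_p|` of the measure `μ_p` on `(-∞,0]`. -/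
def mTot {n : ℕ} (μ : IdxZ n → Measure ℝ) (p : IdxZ n) : ℝ := (μ p (Iic 0)).toReal

/-- Hypothesis (A). -/
def HypA {n : ℕ} (α : ℝ) (μ : IdxZ n → Measure ℝ) (d : IdxZ n → ℝ) : Prop :=
  ∃ lx lz nx nz eta eps : IdxZ n → ℝ,
    (∀ p, lx p ∈ ({1, mTot μ p ^ 2, d p ^ 2, mTot μ p ^ 2 * d p ^ 2} : Set ℝ) ∧
        lz p ∈ ({1, mTot μ p ^ 2, d p ^ 2, mTot μ p ^ 2 * d p ^ 2} : Set ℝ) ∧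
        lx p * lz p = mTot μ p ^ 2 * d p ^ 2 ∧
        nx p ∈ ({1, mTot μ p ^ 2} : Set ℝ) ∧ nz p ∈ ({1, mTot μ p ^ 2} : Set ℝ) ∧
        nx p * nz p = mTot μ p ^ 2 ∧ 0 < eta p ∧ 0 < eps p ∧
        nz p / eta p + lz p / eps p < 2 * α) ∧
    ∀ i : Fin n,
      (∑ k : Fin n, if h : k ≠ i then
          nx ⟨(k, i), h⟩ * eta ⟨(k, i), h⟩ + lx ⟨(k, i), h⟩ * eps ⟨(k, i), h⟩
        else 0) < 2 * α

/-- Directed Hausdorff "distance" between subsets of `C_γ`, w.r.t. `‖·‖_γ`. -/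
def setDistG (γ : ℝ) {n : ℕ} (S T : Set (ℝ → NState n)) : ℝ :=
  sSup ((fun a => sInf ((fun b => gNorm γ (fun s => a s - b s)) '' T)) '' S)


/-- Lower envelope of `chiSet`. -/
def chiL (ε s : ℝ) : ℝ := if s ≤ bfun ε then 0 else 1 - ε

/-- Upper envelope of `chiSet`. -/
def chiU (ε s : ℝ) : ℝ := if s < -bfun ε then ε else 1

/-- Bundled data of the system. -/
structure Dat (n : ℕ) where
  ε : ℝ
  A : Fin n → ℝ → ℝ
  B : IdxZ n → ℝ → ℝ
  μ : IdxZ n → Measure ℝ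
  c : IdxZ n → ℝ
  d : IdxZ n → ℝ
  Γ : Fin n → ℝ
  Istim : Fin n → ℝ → ℝ
  hA : ∀ i, Continuous (A i)
  hA0 : ∀ i s, 0 ≤ A i s
  hB : ∀ i, Continuous (B i)
  hB0 : ∀ i s, 0 ≤ B i s
  hμ : ∀ p, μ p (Iic 0) < ⊤
  hI : ∀ i, Continuous (Istim i)
  hb : 0 ≤ bfun ε
  h0 : 0 ≤ ε
  h1 : ε ≤ 1

theorem bfun_nonneg {ε : ℝ} (h : ε ∈ Icc (0 : ℝ) (1 / 5)) : 0 ≤ bfun ε := by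
  unfold bfun
  split_ifs with h0
  · exact le_rfl
  · have hp : 0 < ε := lt_of_le_of_ne h.1 (Ne.symm h0)
    have h2 := h.2
    refine mul_nonneg h.1 (Real.log_nonneg ?_)
    rw [le_div_iff₀ hp]
    linarith

theorem chiSet_eq {ε : ℝ} (hb : 0 ≤ bfun ε) (s : ℝ) :
    chiSet ε s = Icc (chiL ε s) (chiU ε s) := by
  unfold chiSet chiL chiU
  by_cases h1 : s < -bfun ε
  · have : s ≤ bfun ε := by linarith
    simp [h1, this]
  · by_cases h2 : s ≤ bfun ε <;> simp [h1, h2]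

theorem chiL_mem {ε : ℝ} (h0 : 0 ≤ ε) (h1 : ε ≤ 1) (s : ℝ) : chiL ε s ∈ Icc (0 : ℝ) 1 := by
  unfold chiL
  split_ifs <;> constructor <;> linarith

theorem chiU_mem {ε : ℝ} (h0 : 0 ≤ ε) (h1 : ε ≤ 1) (s : ℝ) : chiU ε s ∈ Icc (0 : ℝ) 1 := by
  unfold chiU
  split_ifs <;> constructor <;> linarith

theorem chiL_le_chiU {ε : ℝ} (hb : 0 ≤ bfun ε) (h0 : 0 ≤ ε) (h1 : ε ≤ 1) (s : ℝ) :
    chiL ε s ≤ chiU ε s := by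
  unfold chiL chiU
  split_ifs <;> linarith

theorem measurable_chiL (ε : ℝ) : Measurable (chiL ε) :=
  Measurable.ite measurableSet_Iic measurable_const measurable_const

theorem measurable_chiU (ε : ℝ) : Measurable (chiU ε) :=
  Measurable.ite measurableSet_Iio measurable_const measurable_const

theorem chiU_usc {ε : ℝ} (h0 : 0 ≤ ε) (h1 : ε ≤ 1) {ι : Type*} {l : Filter ι} {y : ι → ℝ} {y0 : ℝ}
    (hy : Tendsto y l (𝓝 y0)) :
    Tendsto (fun j => max (chiU ε (y j)) (chiU ε y0)) l (𝓝 (chiU ε y0)) := by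
  by_cases h : y0 < -bfun ε
  · refine tendsto_const_nhds.congr' ?_
    filter_upwards [hy.eventually (gt_mem_nhds h)] with j hj
    simp [chiU, h, hj]
  · have h' : chiU ε y0 = 1 := by simp [chiU, h]
    rw [h']
    refine tendsto_const_nhds.congr fun j => ?_
    rw [max_eq_right (chiU_mem h0 h1 _).2]

theorem chiL_lsc {ε : ℝ} (h0 : 0 ≤ ε) (h1 : ε ≤ 1) {ι : Type*} {l : Filter ι} {y : ι → ℝ} {y0 : ℝ}
    (hy : Tendsto y l (𝓝 y0)) :
    Tendsto (fun j => min (chiL ε (y j)) (chiL ε y0)) l (𝓝 (chiL ε y0)) := by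
  by_cases h : y0 ≤ bfun ε
  · have h' : chiL ε y0 = 0 := by simp [chiL, h]
    rw [h']
    refine tendsto_const_nhds.congr fun j => ?_
    rw [min_eq_right (chiL_mem h0 h1 _).1]
  · refine tendsto_const_nhds.congr' ?_
    filter_upwards [hy.eventually (lt_mem_nhds (not_le.1 h))] with j hj
    simp [chiL, h, not_le.2 hj]

theorem integrable_bdd01 {μ : Measure ℝ} (hμ : μ (Iic 0) < ⊤) {g : ℝ → ℝ} (hg : Measurable g)
    (hb : ∀ s, g s ∈ Icc (0 : ℝ) 1) {x : ℝ → ℝ} (hx : ContinuousOn x (Iic 0)) :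
    IntegrableOn (fun τ => g (x τ)) (Iic 0) μ := by
  refine IntegrableOn.of_bound hμ ?_ 1 ?_
  · exact (hg.comp_aemeasurable (hx.aemeasurable measurableSet_Iic)).aestronglyMeasurable
  · refine Eventually.of_forall fun τ => ?_
    rw [Real.norm_eq_abs, abs_le]
    have := hb (x τ)
    constructor <;> linarith [this.1, this.2]

/-- Aumann integral of `χ_ε ∘ x` is a compact interval. -/
theorem aumann_eq {ε : ℝ} (hb : 0 ≤ bfun ε) (h0 : 0 ≤ ε) (h1 : ε ≤ 1) {μ : Measure ℝ}
    (hμ : μ (Iic 0) < ⊤) {x : ℝ → ℝ} (hx : ContinuousOn x (Iic 0)) :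
    aumann (fun τ => chiSet ε (x τ)) μ =
      Icc (∫ τ in Iic (0 : ℝ), chiL ε (x τ) ∂μ) (∫ τ in Iic (0 : ℝ), chiU ε (x τ) ∂μ) := by
  have iL := integrable_bdd01 hμ (measurable_chiL ε) (chiL_mem h0 h1) hx
  have iU := integrable_bdd01 hμ (measurable_chiU ε) (chiU_mem h0 h1) hx
  ext y
  constructor
  · rintro ⟨s, -, hs, hmem, rfl⟩
    simp only [chiSet_eq hb] at hmem
    exact ⟨setIntegral_mono_on iL hs measurableSet_Iic fun t ht => (hmem t ht).1,
      setIntegral_mono_on hs iU measurableSet_Iic fun t ht => (hmem t ht).2⟩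
  · rintro ⟨hl, hu⟩
    set L := ∫ τ in Iic (0 : ℝ), chiL ε (x τ) ∂μ with hL
    set U := ∫ τ in Iic (0 : ℝ), chiU ε (x τ) ∂μ with hU
    have hconv : y ∈ segment ℝ L U := by
      rw [segment_eq_Icc (hl.trans hu)]; exact ⟨hl, hu⟩
    obtain ⟨a, b, ha, hb', hab, rfl⟩ := hconv
    have hxm : Continuous (fun τ => x (min τ 0)) :=
      hx.comp_continuous (continuous_id.min continuous_const) (fun τ => mem_Iic.2 (min_le_right _ _))
    have heq : EqOn (fun τ => a * chiL ε (x (min τ 0)) + b * chiU ε (x (min τ 0)))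
        (fun τ => a * chiL ε (x τ) + b * chiU ε (x τ)) (Iic 0) := by
      intro τ hτ
      simp only [min_eq_left (mem_Iic.1 hτ)]
    refine ⟨fun τ => a * chiL ε (x (min τ 0)) + b * chiU ε (x (min τ 0)), ?_, ?_, ?_, ?_⟩
    · exact (((measurable_chiL ε).comp hxm.measurable).const_mul a).add
        (((measurable_chiU ε).comp hxm.measurable).const_mul b)
    · rw [integrableOn_congr_fun heq measurableSet_Iic]
      exact (Integrable.const_mul iL a).add (Integrable.const_mul iU b)
    · intro t ht
      simp only [min_eq_left ht, chiSet_eq hb]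
      have h := chiL_le_chiU hb h0 h1 (x t)
      rw [← segment_eq_Icc h]
      exact ⟨a, b, ha, hb', hab, rfl⟩
    · rw [setIntegral_congr_fun measurableSet_Iic heq,
        integral_add (Integrable.const_mul iL a) (Integrable.const_mul iU b),
        integral_const_mul, integral_const_mul]
      simp [hL, hU]

theorem upI_usc {ε : ℝ} (h0 : 0 ≤ ε) (h1 : ε ≤ 1) {μ : Measure ℝ}
    (hμ : μ (Iic 0) < ⊤) {ι : Type*} {l : Filter ι} [l.IsCountablyGenerated] {x : ι → ℝ → ℝ}
    {x0 : ℝ → ℝ} (hx : ∀ᶠ j in l, ContinuousOn (x j) (Iic 0)) (hx0 : ContinuousOn x0 (Iic 0))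
    (hlim : ∀ τ ≤ (0 : ℝ), Tendsto (fun j => x j τ) l (𝓝 (x0 τ))) {δ : ℝ} (hδ : 0 < δ) :
    ∀ᶠ j in l, ∫ τ in Iic (0 : ℝ), chiU ε (x j τ) ∂μ ≤
      ∫ τ in Iic (0 : ℝ), chiU ε (x0 τ) ∂μ + δ := by
  have iU := fun {y : ℝ → ℝ} (hy : ContinuousOn y (Iic 0)) =>
    integrable_bdd01 hμ (measurable_chiU ε) (chiU_mem h0 h1) hy
  have key : Tendsto (fun j => ∫ τ in Iic (0 : ℝ), max (chiU ε (x j τ)) (chiU ε (x0 τ)) ∂μ) l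
      (𝓝 (∫ τ in Iic (0 : ℝ), chiU ε (x0 τ) ∂μ)) := by
    refine tendsto_integral_filter_of_dominated_convergence (fun _ => 1) ?_ ?_ ?_ ?_
    · filter_upwards [hx] with j hj
      exact ((iU hj).sup (iU hx0)).aestronglyMeasurable
    · refine Eventually.of_forall fun j => Eventually.of_forall fun τ => ?_
      rw [Real.norm_eq_abs, abs_of_nonneg (le_max_of_le_left (chiU_mem h0 h1 _).1)]
      exact max_le (chiU_mem h0 h1 _).2 (chiU_mem h0 h1 _).2
    · exact integrableOn_const hμ.ne
    · refine (ae_restrict_iff' measurableSet_Iic).2 (Eventually.of_forall fun τ hτ => ?_)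
      exact chiU_usc h0 h1 (hlim τ hτ)
  filter_upwards [hx, key.eventually (gt_mem_nhds (lt_add_of_pos_right _ hδ))] with j hj h2
  refine le_trans ?_ h2.le
  exact integral_mono (iU hj) ((iU hj).sup (iU hx0)) fun τ => le_max_left _ _

theorem loI_lsc {ε : ℝ} (h0 : 0 ≤ ε) (h1 : ε ≤ 1) {μ : Measure ℝ}
    (hμ : μ (Iic 0) < ⊤) {ι : Type*} {l : Filter ι} [l.IsCountablyGenerated] {x : ι → ℝ → ℝ}
    {x0 : ℝ → ℝ} (hx : ∀ᶠ j in l, ContinuousOn (x j) (Iic 0)) (hx0 : ContinuousOn x0 (Iic 0))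
    (hlim : ∀ τ ≤ (0 : ℝ), Tendsto (fun j => x j τ) l (𝓝 (x0 τ))) {δ : ℝ} (hδ : 0 < δ) :
    ∀ᶠ j in l, ∫ τ in Iic (0 : ℝ), chiL ε (x0 τ) ∂μ - δ ≤
      ∫ τ in Iic (0 : ℝ), chiL ε (x j τ) ∂μ := by
  have iL := fun {y : ℝ → ℝ} (hy : ContinuousOn y (Iic 0)) =>
    integrable_bdd01 hμ (measurable_chiL ε) (chiL_mem h0 h1) hy
  have key : Tendsto (fun j => ∫ τ in Iic (0 : ℝ), min (chiL ε (x j τ)) (chiL ε (x0 τ)) ∂μ) l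
      (𝓝 (∫ τ in Iic (0 : ℝ), chiL ε (x0 τ) ∂μ)) := by
    refine tendsto_integral_filter_of_dominated_convergence (fun _ => 1) ?_ ?_ ?_ ?_
    · filter_upwards [hx] with j hj
      exact ((iL hj).inf (iL hx0)).aestronglyMeasurable
    · refine Eventually.of_forall fun j => Eventually.of_forall fun τ => ?_
      rw [Real.norm_eq_abs, abs_of_nonneg (le_min (chiL_mem h0 h1 _).1 (chiL_mem h0 h1 _).1)]
      exact min_le_of_left_le (chiL_mem h0 h1 _).2
    · exact integrableOn_const hμ.ne
    · refine (ae_restrict_iff' measurableSet_Iic).2 (Eventually.of_forall fun τ hτ => ?_)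
      exact chiL_lsc h0 h1 (hlim τ hτ)
  filter_upwards [hx, key.eventually (lt_mem_nhds (sub_lt_self _ hδ))] with j hj h2
  refine le_trans h2.le ?_
  exact integral_mono ((iL hj).inf (iL hx0)) (iL hj) fun τ => min_le_left _ _

namespace Dat

variable {n : ℕ} (P : Dat n)

/-- Vector of lower integrals. -/
def lo (w : ℝ → NState n) : IdxZ n → ℝ := fun p =>
  ∫ τ in Iic (0 : ℝ), chiL P.ε ((w τ).1 p.1.1 - P.Γ p.1.1) ∂(P.μ p)

/-- Vector of upper integrals. -/
def up (w : ℝ → NState n) : IdxZ n → ℝ := fun p =>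
  ∫ τ in Iic (0 : ℝ), chiU P.ε ((w τ).1 p.1.1 - P.Γ p.1.1) ∂(P.μ p)

/-- The interaction map. -/
def Tm (y : NState n) (m : (IdxZ n → ℝ) × (IdxZ n → ℝ)) : NState n :=
  (fun i => ∑ k : Fin n, if h : k ≠ i then
      (y.2 ⟨(k, i), h⟩ - P.c ⟨(k, i), h⟩) * m.1 ⟨(k, i), h⟩ else 0,
    fun p => (P.d p * max (y.1 p.1.2) 0) * m.2 p)

/-- The decay term as a function of the current state. -/
def Dy (y : NState n) : NState n :=
  (fun i => -(P.A i (y.1 i)) * y.1 i, fun p => -(P.B p (y.2 p)) * y.2 p)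

/-- The set of parameters. -/
def K (w : ℝ → NState n) : Set ((IdxZ n → ℝ) × (IdxZ n → ℝ)) :=
  Icc (P.lo w) (P.up w) ×ˢ Icc (P.lo w) (P.up w)

/-- real clamp -/
def cl (R x : ℝ) : ℝ := max (-R) (min R x)

/-- componentwise clamp -/
def clV (R : ℝ) (y : NState n) : NState n := (fun i => cl R (y.1 i), fun p => cl R (y.2 p))

/-- Full right-hand side. -/
def H (R : ℝ) (q : (ℝ × NState n) × ((IdxZ n → ℝ) × (IdxZ n → ℝ))) : NState n :=
  P.Dy (clV R q.1.2) + P.Tm (clV R q.1.2) q.2 + stimT P.Istim q.1.1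

/-- Truncated right-hand side set. -/
def Fset (R s : ℝ) (w : ℝ → NState n) : Set (NState n) :=
  (fun m => P.H R ((s, w 0), m)) '' P.K w

theorem continuous_Tm : Continuous (fun q : NState n × ((IdxZ n → ℝ) × (IdxZ n → ℝ)) =>
    P.Tm q.1 q.2) := by
  unfold Tm
  refine Continuous.prodMk (continuous_pi fun i => continuous_finsetSum _ fun k _ => ?_)
    (continuous_pi fun p => ?_)
  · by_cases h : k ≠ i
    · simp only [h, dite_true, ne_eq, not_false_eq_true]
      fun_prop
    · simp only [h, dite_false]
      fun_prop
  · fun_prop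

theorem continuous_Dy : Continuous P.Dy := by
  unfold Dy
  have h1 := P.hA
  have h2 := P.hB
  refine Continuous.prodMk (continuous_pi fun i => ?_) (continuous_pi fun p => ?_)
  · have := h1 i
    fun_prop
  · have := h2 p
    fun_prop

theorem continuous_clV (R : ℝ) : Continuous (clV (n := n) R) := by
  unfold clV cl
  fun_prop

theorem continuous_stim : Continuous (stimT P.Istim) := by
  unfold stimT
  have h := P.hI
  exact Continuous.prodMk (continuous_pi fun i => h i) continuous_const

theorem continuous_H (R : ℝ) : Continuous (P.H R) := by
  unfold H
  refine Continuous.add (Continuous.add ?_ ?_) ?_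
  · exact P.continuous_Dy.comp ((continuous_clV R).comp (by fun_prop))
  · exact P.continuous_Tm.comp (Continuous.prodMk ((continuous_clV R).comp (by fun_prop)) (by fun_prop))
  · exact P.continuous_stim.comp (by fun_prop)

theorem cl_of_abs_le {R x : ℝ} (h : |x| ≤ R) : cl R x = x := by
  unfold cl
  rw [min_eq_right (abs_le.1 h).2, max_eq_right (abs_le.1 h).1]

theorem abs_cl_le {R x : ℝ} (h : 0 ≤ R) : |cl R x| ≤ R := by
  unfold cl
  rw [abs_le]
  exact ⟨le_max_left _ _, max_le (by linarith) (min_le_left _ _)⟩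

theorem norm1_le (y : NState n) (i) : |y.1 i| ≤ ‖y‖ :=
  (norm_le_pi_norm y.1 i).trans (norm_fst_le y)

theorem norm2_le (y : NState n) (i) : |y.2 i| ≤ ‖y‖ :=
  (norm_le_pi_norm y.2 i).trans (norm_snd_le y)

theorem norm_le_of {y : NState n} {C : ℝ} (hC : 0 ≤ C) (h1 : ∀ i, |y.1 i| ≤ C)
    (h2 : ∀ i, |y.2 i| ≤ C) : ‖y‖ ≤ C :=
  norm_prod_le_iff.2 ⟨(pi_norm_le_iff_of_nonneg hC).2 h1, (pi_norm_le_iff_of_nonneg hC).2 h2⟩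

theorem clV_of_norm_le {R : ℝ} {y : NState n} (h : ‖y‖ ≤ R) : clV R y = y := by
  unfold clV
  ext i
  · exact cl_of_abs_le ((norm1_le y i).trans h)
  · exact cl_of_abs_le ((norm2_le y i).trans h)

theorem norm_clV_le {R : ℝ} (hR : 0 ≤ R) (y : NState n) : ‖clV R y‖ ≤ R :=
  norm_le_of hR (fun _ => abs_cl_le hR) (fun _ => abs_cl_le hR)

theorem contx {w : ℝ → NState n} (hw : ContinuousOn w (Iic 0)) (k : Fin n) :
    ContinuousOn (fun τ => (w τ).1 k - P.Γ k) (Iic 0) := by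
  have : Continuous (fun y : NState n => y.1 k - P.Γ k) := by fun_prop
  exact this.comp_continuousOn hw

theorem lo_le_up {w : ℝ → NState n} (hw : ContinuousOn w (Iic 0)) : P.lo w ≤ P.up w := fun p =>
  integral_mono (integrable_bdd01 (P.hμ p) (measurable_chiL _) (chiL_mem P.h0 P.h1) (P.contx hw _))
    (integrable_bdd01 (P.hμ p) (measurable_chiU _) (chiU_mem P.h0 P.h1) (P.contx hw _))
    (fun _ => chiL_le_chiU P.hb P.h0 P.h1 _)

/-- Total mass vector -/
def tot : IdxZ n → ℝ := fun p => (P.μ p).real (Iic 0)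

theorem lo_nonneg (w : ℝ → NState n) : 0 ≤ P.lo w := fun _ =>
  integral_nonneg fun _ => (chiL_mem P.h0 P.h1 _).1

theorem up_le_tot {w : ℝ → NState n} (hw : ContinuousOn w (Iic 0)) : P.up w ≤ P.tot := fun p => by
  have h := integral_mono (μ := (P.μ p).restrict (Iic 0))
    (integrable_bdd01 (P.hμ p) (measurable_chiU _) (chiU_mem P.h0 P.h1) (P.contx hw p.1.1))
    (integrableOn_const (C := (1 : ℝ)) (P.hμ p).ne) (fun _ => (chiU_mem P.h0 P.h1 _).2)
  simpa [up, tot] using h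

theorem isCompact_K (w : ℝ → NState n) : IsCompact (P.K w) := isCompact_Icc.prod isCompact_Icc

theorem convex_K (w : ℝ → NState n) : Convex ℝ (P.K w) := (convex_Icc _ _).prod (convex_Icc _ _)

theorem up_mem_K {w : ℝ → NState n} (hw : ContinuousOn w (Iic 0)) : (P.up w, P.up w) ∈ P.K w :=
  ⟨⟨P.lo_le_up hw, le_rfl⟩, ⟨P.lo_le_up hw, le_rfl⟩⟩

theorem nonempty_Fset (R s : ℝ) {w : ℝ → NState n} (hw : ContinuousOn w (Iic 0)) :
    (P.Fset R s w).Nonempty := ⟨_, _, P.up_mem_K hw, rfl⟩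

theorem isCompact_Fset (R s : ℝ) (w : ℝ → NState n) : IsCompact (P.Fset R s w) :=
  (P.isCompact_K w).image ((P.continuous_H R).comp (by fun_prop))

theorem Tm_affine (y : NState n) (m m' : (IdxZ n → ℝ) × (IdxZ n → ℝ)) (a b : ℝ) :
    P.Tm y (a • m + b • m') = a • P.Tm y m + b • P.Tm y m' := by
  unfold Tm
  ext i
  · simp only [Prod.fst_add, Prod.smul_fst, Pi.add_apply, Pi.smul_apply, smul_eq_mul,
      Finset.mul_sum, ← Finset.sum_add_distrib]
    refine Finset.sum_congr rfl fun k _ => ?_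
    split_ifs <;> ring
  · simp only [Prod.snd_add, Prod.smul_snd, Pi.add_apply, Pi.smul_apply, smul_eq_mul]
    ring

theorem convex_Fset (R s : ℝ) (w : ℝ → NState n) : Convex ℝ (P.Fset R s w) := by
  rintro _ ⟨m, hm, rfl⟩ _ ⟨m', hm', rfl⟩ a b ha hb hab
  refine ⟨a • m + b • m', P.convex_K w hm hm' ha hb hab, ?_⟩
  simp only [H, Tm_affine]
  have e : ∀ v : NState n, v = a • v + b • v := fun v => by rw [← add_smul, hab, one_smul]
  conv_lhs => rw [e (P.Dy _), e (stimT _ _)]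
  simp only [smul_add]
  abel

theorem Xset_eq {w : ℝ → NState n} (hw : ContinuousOn w (Iic 0)) :
    Xset P.ε P.μ P.c P.d P.Γ w = P.Tm (w 0) '' P.K w := by
  have hau : ∀ p : IdxZ n, aumann (fun τ => chiSet P.ε ((w τ).1 p.1.1 - P.Γ p.1.1)) (P.μ p) =
      Icc (P.lo w p) (P.up w p) := fun p =>
    aumann_eq P.hb P.h0 P.h1 (P.hμ p) (P.contx hw p.1.1)
  ext v
  constructor
  · rintro ⟨h1, h2⟩
    have h1' : ∀ i, ∃ g : Fin n → ℝ, g i = 0 ∧ (∀ k, ∀ h : k ≠ i, ∃ m ∈ Icc (P.lo w ⟨(k,i),h⟩)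
        (P.up w ⟨(k,i),h⟩), ((w 0).2 ⟨(k, i), h⟩ - P.c ⟨(k, i), h⟩) * m = g k) ∧
        v.1 i = ∑ k, g k := by
      intro i
      obtain ⟨g, hg, hk, hs⟩ := h1 i
      refine ⟨g, hg, fun k h => ?_, hs⟩
      have := hk k h
      rw [hau ⟨(k,i),h⟩] at this
      exact this
    choose g hg hk hs using h1'
    choose m hm hmg using hk
    have h2' : ∀ p : IdxZ n, ∃ m ∈ Icc (P.lo w p) (P.up w p),
        (P.d p * max ((w 0).1 p.1.2) 0) * m = v.2 p := by
      intro p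
      have := h2 p
      rw [hau p] at this
      exact this
    choose m2 hm2 hv2 using h2'
    refine ⟨(fun p => m p.1.2 p.1.1 p.2, m2), ⟨?_, ?_⟩, ?_⟩
    · exact ⟨fun p => (hm p.1.2 p.1.1 p.2).1, fun p => (hm p.1.2 p.1.1 p.2).2⟩
    · exact ⟨fun p => (hm2 p).1, fun p => (hm2 p).2⟩
    · ext i
      · simp only [Tm]
        rw [hs i]
        refine Finset.sum_congr rfl fun k _ => ?_
        split_ifs with h
        · exact hmg i k h
        · simp only [ne_eq, not_not] at h
          rw [h, hg]
      · exact hv2 i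
  · rintro ⟨m, ⟨hm1, hm2⟩, rfl⟩
    refine ⟨fun i => ⟨fun k => if h : k ≠ i then
      ((w 0).2 ⟨(k, i), h⟩ - P.c ⟨(k, i), h⟩) * m.1 ⟨(k, i), h⟩ else 0, by simp, ?_, rfl⟩, ?_⟩
    · intro k h
      rw [hau ⟨(k,i),h⟩]
      simp only [h, ne_eq, not_false_eq_true, dite_true]
      exact ⟨m.1 ⟨(k,i),h⟩, ⟨hm1.1 _, hm1.2 _⟩, rfl⟩
    · intro p
      rw [hau p]
      exact ⟨m.2 p, ⟨hm2.1 _, hm2.2 _⟩, rfl⟩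

theorem decayT_eq (w : ℝ → NState n) : decayT P.A P.B w = P.Dy (w 0) := rfl

/-- If the current state is not truncated then `Fset` is the actual right-hand side. -/
theorem mem_Fset_iff {R s : ℝ} {w : ℝ → NState n} (hw : ContinuousOn w (Iic 0)) (hR : ‖w 0‖ ≤ R)
    (v : NState n) : v ∈ P.Fset R s w ↔
      ∃ S ∈ Xset P.ε P.μ P.c P.d P.Γ w, v = decayT P.A P.B w + S + stimT P.Istim s := by
  rw [P.Xset_eq hw]
  simp only [Fset, H, clV_of_norm_le hR, decayT_eq]
  constructor
  · rintro ⟨m, hm, rfl⟩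
    exact ⟨_, ⟨m, hm, rfl⟩, rfl⟩
  · rintro ⟨_, ⟨m, hm, rfl⟩, rfl⟩
    exact ⟨m, hm, rfl⟩

/-- Uniform bound. -/
theorem exists_bound (R a b : ℝ) (hR : 0 ≤ R) : ∃ M : ℝ, 0 ≤ M ∧ ∀ s ∈ Icc a b,
    ∀ w : ℝ → NState n, ContinuousOn w (Iic 0) → ∀ v ∈ P.Fset R s w, ‖v‖ ≤ M := by
  have hc : IsCompact ((Icc a b ×ˢ Metric.closedBall (0 : NState n) R) ×ˢ
      (Icc 0 P.tot ×ˢ Icc 0 P.tot)) :=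
    (isCompact_Icc.prod (isCompact_closedBall _ _)).prod (isCompact_Icc.prod isCompact_Icc)
  obtain ⟨M, hM⟩ := hc.exists_bound_of_continuousOn (P.continuous_H R).continuousOn
  refine ⟨max M 0, le_max_right _ _, ?_⟩
  rintro s hs w hw _ ⟨m, ⟨hm1, hm2⟩, rfl⟩
  refine le_max_of_le_left ?_
  have : P.H R ((s, w 0), m) = P.H R ((s, clV R (w 0)), m) := by
    simp only [H, clV_of_norm_le (norm_clV_le hR (w 0))]
  change ‖P.H R ((s, w 0), m)‖ ≤ M
  rw [this]
  refine hM _ ⟨⟨hs, ?_⟩, ⟨?_, ?_⟩⟩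
  · simpa using norm_clV_le hR (w 0)
  · exact ⟨(P.lo_nonneg w).trans hm1.1, hm1.2.trans (P.up_le_tot hw)⟩
  · exact ⟨(P.lo_nonneg w).trans hm2.1, hm2.2.trans (P.up_le_tot hw)⟩

theorem exists_near {a b m : IdxZ n → ℝ} (hab : a ≤ b) {η : ℝ} (hη : 0 ≤ η)
    (h : ∀ p, a p - η ≤ m p ∧ m p ≤ b p + η) : ∃ m' ∈ Icc a b, dist m m' ≤ η := by
  refine ⟨fun p => max (a p) (min (b p) (m p)), ⟨fun p => le_max_left _ _,
    fun p => max_le (hab p) (min_le_left _ _)⟩, (dist_pi_le_iff hη).2 fun p => ?_⟩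
  have h1 := (h p).1
  have h2 := (h p).2
  have h3 := hab p
  rw [Real.dist_eq, abs_le]
  constructor
  · have : max (a p) (min (b p) (m p)) ≤ m p + η :=
      max_le (by linarith) ((min_le_right _ _).trans (by linarith))
    linarith
  · have : m p - η ≤ max (a p) (min (b p) (m p)) := le_max_of_le_right (le_min (by linarith) (by linarith))
    linarith

/-- Upper semicontinuity of the right-hand side. -/
theorem Fset_usc (R : ℝ) {ι : Type*} {l : Filter ι} [l.IsCountablyGenerated] {s : ι → ℝ} {t : ℝ}
    {w : ι → ℝ → NState n} {w0 : ℝ → NState n} (hs : Tendsto s l (𝓝 t))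
    (hw : ∀ᶠ j in l, ContinuousOn (w j) (Iic 0)) (hw0 : ContinuousOn w0 (Iic 0))
    (hlim : ∀ τ ≤ (0 : ℝ), Tendsto (fun j => w j τ) l (𝓝 (w0 τ))) {δ : ℝ} (hδ : 0 < δ) :
    ∀ᶠ j in l, P.Fset R (s j) (w j) ⊆ Metric.cthickening δ (P.Fset R t w0) := by
  have hUo : IsOpen (P.H R ⁻¹' Metric.thickening δ (P.Fset R t w0)) :=
    Metric.isOpen_thickening.preimage (P.continuous_H R)
  have hsub : ({(t, w0 0)} : Set (ℝ × NState n)) ×ˢ P.K w0 ⊆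
      P.H R ⁻¹' Metric.thickening δ (P.Fset R t w0) := by
    rintro ⟨q, m⟩ ⟨hq, hm⟩
    obtain rfl : q = (t, w0 0) := hq
    exact Metric.self_subset_thickening hδ _ ⟨m, hm, rfl⟩
  obtain ⟨V1, V2, hV1, hV2, hK1, hK2, hV⟩ :=
    generalized_tube_lemma isCompact_singleton (P.isCompact_K w0) hUo hsub
  obtain ⟨η, hη, hth⟩ := (P.isCompact_K w0).exists_thickening_subset_open hV2 hK2
  have e1 : ∀ᶠ j in l, (s j, w j 0) ∈ V1 :=
    (hs.prodMk_nhds (hlim 0 le_rfl)).eventually (hV1.mem_nhds (singleton_subset_iff.1 hK1))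
  have hx : ∀ k : Fin n, ∀ᶠ j in l, ContinuousOn (fun τ => (w j τ).1 k - P.Γ k) (Iic 0) :=
    fun k => hw.mono fun j hj => P.contx hj k
  have hl : ∀ k : Fin n, ∀ τ ≤ (0 : ℝ), Tendsto (fun j => (w j τ).1 k - P.Γ k) l
      (𝓝 ((w0 τ).1 k - P.Γ k)) := fun k τ hτ => by
    have : Continuous (fun y : NState n => y.1 k - P.Γ k) := by fun_prop
    exact (this.tendsto _).comp (hlim τ hτ)
  have e2 : ∀ᶠ j in l, ∀ p, P.up (w j) p ≤ P.up w0 p + η / 2 :=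
    eventually_all.2 fun p => upI_usc P.h0 P.h1 (P.hμ p) (hx p.1.1) (P.contx hw0 _) (hl _)
      (half_pos hη)
  have e3 : ∀ᶠ j in l, ∀ p, P.lo w0 p - η / 2 ≤ P.lo (w j) p :=
    eventually_all.2 fun p => loI_lsc P.h0 P.h1 (P.hμ p) (hx p.1.1) (P.contx hw0 _) (hl _)
      (half_pos hη)
  filter_upwards [e1, e2, e3] with j h1 h2 h3
  rintro _ ⟨m, ⟨hm1, hm2⟩, rfl⟩
  obtain ⟨a, ha, hda⟩ := exists_near (m := m.1) (P.lo_le_up hw0) (half_pos hη).le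
    (fun p => ⟨(h3 p).trans (hm1.1 p), (hm1.2 p).trans (h2 p)⟩)
  obtain ⟨b, hb, hdb⟩ := exists_near (m := m.2) (P.lo_le_up hw0) (half_pos hη).le
    (fun p => ⟨(h3 p).trans (hm2.1 p), (hm2.2 p).trans (h2 p)⟩)
  have hmem : m ∈ V2 := by
    refine hth (Metric.mem_thickening_iff.2 ⟨(a, b), ⟨ha, hb⟩, ?_⟩)
    refine lt_of_le_of_lt (max_le hda hdb) (half_lt_self hη)
  exact Metric.thickening_subset_cthickening _ _ (hV (show ((s j, w j 0), m) ∈ _ from ⟨h1, hmem⟩))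

end Dat

namespace Dat

variable {n : ℕ} (P : Dat n)

theorem cont_glue {t₀ t₁ : ℝ} (ht : t₀ ≤ t₁) {u₀ u : ℝ → NState n} (hu₀ : ContinuousOn u₀ (Iic 0))
    (hini : ∀ t ≤ t₀, u t = u₀ (t - t₀)) (hu : ContinuousOn u (Icc t₀ t₁)) :
    ContinuousOn u (Iic t₁) := by
  rw [← Iic_union_Icc_eq_Iic ht]
  refine ContinuousOn.union_of_isClosed ?_ hu isClosed_Iic isClosed_Icc
  have : ContinuousOn (fun t => u₀ (t - t₀)) (Iic t₀) :=
    hu₀.comp (by fun_prop) (fun t ht => by simpa using ht)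
  exact this.congr fun t ht => hini t ht

theorem cont_hist {t₁ s : ℝ} {u : ℝ → NState n} (hu : ContinuousOn u (Iic t₁)) (hs : s ≤ t₁) :
    ContinuousOn (hist u s) (Iic 0) := by
  refine hu.comp (f := fun τ => s + τ) (by fun_prop) (fun τ hτ => ?_)
  have : τ ≤ 0 := hτ
  exact mem_Iic.2 (by linarith)

theorem lip_of_integral {t₀ t₁ M : ℝ} {u f : ℝ → NState n} {a : NState n}
    (hf : IntegrableOn f (Icc t₀ t₁)) (hM : ∀ s ∈ Icc t₀ t₁, ‖f s‖ ≤ M)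
    (heq : ∀ t ∈ Icc t₀ t₁, u t = a + ∫ s in t₀..t, f s) :
    ∀ s ∈ Icc t₀ t₁, ∀ t ∈ Icc t₀ t₁, u t - u s = ∫ r in s..t, f r ∧ ‖u t - u s‖ ≤ M * |t - s| := by
  intro s hs t ht
  have ii : ∀ x ∈ Icc t₀ t₁, ∀ y ∈ Icc t₀ t₁, IntervalIntegrable f volume x y := fun x hx y hy =>
    (hf.mono_set (uIcc_subset_Icc hx hy)).intervalIntegrable
  have h0 : t₀ ∈ Icc t₀ t₁ := ⟨le_rfl, hs.1.trans hs.2⟩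
  have e : u t - u s = ∫ r in s..t, f r := by
    rw [heq t ht, heq s hs, add_sub_add_left_eq_sub,
      intervalIntegral.integral_interval_sub_left (ii _ h0 _ ht) (ii _ h0 _ hs)]
  refine ⟨e, ?_⟩
  rw [e]
  refine intervalIntegral.norm_integral_le_of_norm_le_const fun r hr => hM r ?_
  exact uIcc_subset_Icc hs ht (uIoc_subset_uIcc hr)

theorem conv_joint {t₀ t₁ M : ℝ} (ht : t₀ ≤ t₁) {u₀ u : ℝ → NState n} {uk : ℕ → ℝ → NState n}
    (hu₀ : ContinuousOn u₀ (Iic 0))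
    (hini : ∀ k, ∀ t ≤ t₀, uk k t = u₀ (t - t₀)) (initu : ∀ t ≤ t₀, u t = u₀ (t - t₀))
    (hlip : ∀ k, ∀ s ∈ Icc t₀ t₁, ∀ t ∈ Icc t₀ t₁, ‖uk k t - uk k s‖ ≤ M * |t - s|)
    (conv : ∀ t ∈ Icc t₀ t₁, Tendsto (fun k => uk k t) atTop (𝓝 (u t)))
    {ι : Type*} {l : Filter ι} {k : ι → ℕ} {r : ι → ℝ} {r₀ : ℝ} (hk : Tendsto k l atTop)
    (hr : Tendsto r l (𝓝 r₀)) (hr₀ : r₀ ≤ t₁) (hr1 : ∀ᶠ j in l, r j ≤ t₁) :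
    Tendsto (fun j => uk (k j) (r j)) l (𝓝 (u r₀)) := by
  have rep : ∀ v : ℝ → NState n, (∀ t ≤ t₀, v t = u₀ (t - t₀)) → ∀ r,
      v r = u₀ (min (r - t₀) 0) + (v (max r t₀) - u₀ 0) := by
    intro v hv r
    rcases le_total r t₀ with h | h
    · rw [max_eq_right h, hv r h, hv t₀ le_rfl, min_eq_left (by linarith)]; simp
    · rw [max_eq_left h, min_eq_right (by linarith)]; simp
  rw [rep u initu r₀]
  simp_rw [fun j => rep (uk (k j)) (hini (k j)) (r j)]
  have c0 : Continuous (fun r => u₀ (min (r - t₀) 0)) :=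
    hu₀.comp_continuous (by fun_prop) (fun τ => mem_Iic.2 (min_le_right _ _))
  refine ((c0.tendsto r₀).comp hr).add (Tendsto.sub ?_ tendsto_const_nhds)
  have m0 : max r₀ t₀ ∈ Icc t₀ t₁ := ⟨le_max_right _ _, max_le hr₀ ht⟩
  have h1 : Tendsto (fun j => uk (k j) (max r₀ t₀)) l (𝓝 (u (max r₀ t₀))) := (conv _ m0).comp hk
  have h2 : Tendsto (fun j => uk (k j) (max (r j) t₀) - uk (k j) (max r₀ t₀)) l (𝓝 0) := by
    have hmax : Tendsto (fun j => M * |max (r j) t₀ - max r₀ t₀|) l (𝓝 0) := by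
      have : Continuous (fun x : ℝ => M * |max x t₀ - max r₀ t₀|) := by fun_prop
      have h3 := (this.tendsto r₀).comp hr
      simpa [Function.comp_def] using h3
    refine squeeze_zero_norm' ?_ hmax
    filter_upwards [hr1] with j hj
    exact hlip _ _ m0 _ ⟨le_max_right _ _, max_le hj ht⟩
  simpa using h2.add h1

theorem deriv_mem {R t₀ t₁ M : ℝ} (ht : t₀ ≤ t₁) {u₀ u : ℝ → NState n} {uk : ℕ → ℝ → NState n}
    {f : ℕ → ℝ → NState n} {h : ℕ → ℝ} (hh0 : ∀ k, 0 ≤ h k) (hh : Tendsto h atTop (𝓝 0))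
    (hu₀ : ContinuousOn u₀ (Iic 0))
    (hini : ∀ k, ∀ t ≤ t₀, uk k t = u₀ (t - t₀)) (initu : ∀ t ≤ t₀, u t = u₀ (t - t₀))
    (hcu : ContinuousOn u (Iic t₁)) (hcuk : ∀ k, ContinuousOn (uk k) (Iic t₁))
    (hf : ∀ k, IntegrableOn (f k) (Icc t₀ t₁))
    (hlip : ∀ k, ∀ s ∈ Icc t₀ t₁, ∀ t ∈ Icc t₀ t₁, uk k t - uk k s = ∫ r in s..t, f k r ∧
      ‖uk k t - uk k s‖ ≤ M * |t - s|)
    (hmem : ∀ k, ∀ s ∈ Icc t₀ t₁, f k s ∈ P.Fset R s (hist (uk k) (s - h k)))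
    (conv : ∀ t ∈ Icc t₀ t₁, Tendsto (fun k => uk k t) atTop (𝓝 (u t)))
    {t : ℝ} (htt : t ∈ Ioo t₀ t₁) {v : NState n} (hv : HasDerivAt u v t) :
    v ∈ P.Fset R t (hist u t) := by
  set C := P.Fset R t (hist u t) with hC
  have hcl : IsClosed C := (P.isCompact_Fset _ _ _).isClosed
  rw [← hcl.closure_eq, Metric.closure_eq_iInter_cthickening]
  refine mem_iInter₂.2 fun δ hδ => ?_
  have ev1 : ∀ᶠ j : ℕ × ℝ in atTop ×ˢ 𝓝 t, j.2 ≤ t₁ :=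
    tendsto_snd.eventually (ge_mem_nhds htt.2)
  have tr : ∀ τ : ℝ, Tendsto (fun j : ℕ × ℝ => j.2 - h j.1 + τ) (atTop ×ˢ 𝓝 t) (𝓝 (t + τ)) := by
    intro τ
    have := ((tendsto_snd (f := (atTop : Filter ℕ)) (g := 𝓝 t)).sub
      (hh.comp (tendsto_fst (f := (atTop : Filter ℕ)) (g := 𝓝 t)))).add_const τ
    simpa using this
  have usc := P.Fset_usc R (l := (atTop : Filter ℕ) ×ˢ 𝓝 t) (s := fun j => j.2) (t := t)
    (w := fun j => hist (uk j.1) (j.2 - h j.1)) (w0 := hist u t) tendsto_snd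
    (by
      filter_upwards [ev1] with j hj
      exact cont_hist (hcuk j.1) (by linarith [hh0 j.1]))
    (cont_hist hcu htt.2.le)
    (by
      intro τ hτ
      refine conv_joint ht hu₀ hini initu (fun k s hs t ht => (hlip k s hs t ht).2) conv tendsto_fst
        (tr τ) (by linarith [htt.2]) ?_
      filter_upwards [ev1] with j hj
      linarith [hh0 j.1]) hδ
  obtain ⟨pa, hpa, pb, hpb, hab⟩ := eventually_prod_iff.1 usc
  obtain ⟨η, hη, hball⟩ := Metric.eventually_nhds_iff.1 hpb
  have conv' : Convex ℝ (Metric.cthickening δ C) := (P.convex_Fset _ _ _).cthickening δ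
  have closed' : IsClosed (Metric.cthickening δ C) := Metric.isClosed_cthickening
  have slope_mem : ∀ t' ∈ Ioo t (min (t + η) t₁), slope u t t' ∈ Metric.cthickening δ C := by
    intro t' ht'
    have h1 : t' < t + η := lt_of_lt_of_le ht'.2 (min_le_left _ _)
    have h2 : t' < t₁ := lt_of_lt_of_le ht'.2 (min_le_right _ _)
    have mt : t ∈ Icc t₀ t₁ := ⟨htt.1.le, htt.2.le⟩
    have mt' : t' ∈ Icc t₀ t₁ := ⟨htt.1.le.trans ht'.1.le, h2.le⟩
    have lim : Tendsto (fun k => slope (uk k) t t') atTop (𝓝 (slope u t t')) := by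
      simp only [slope_def_module]
      exact ((conv t' mt').sub (conv t mt)).const_smul _
    refine closed'.mem_of_tendsto lim ?_
    filter_upwards [hpa] with k hk
    have avg : slope (uk k) t t' = ⨍ r in t..t', f k r := by
      rw [interval_average_eq, slope_def_module, (hlip k t mt t' mt').1]
    rw [avg, uIoc_of_le ht'.1.le]
    have hsub : Ioc t t' ⊆ Icc t₀ t₁ := fun r hr => ⟨htt.1.le.trans hr.1.le, hr.2.trans h2.le⟩
    refine conv'.set_average_mem closed' ?_ ?_ ?_ ((hf k).mono_set hsub)
    · simp [ht'.1]
    · simp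
    · refine (ae_restrict_iff' measurableSet_Ioc).2 (Eventually.of_forall fun r hr => ?_)
      refine hab hk (y := r) (hball ?_) (hmem k r (hsub hr))
      rw [Real.dist_eq, abs_of_pos (by linarith [hr.1])]
      linarith [hr.2]
  have hs := (hasDerivAt_iff_tendsto_slope.1 hv).mono_left
    (nhdsWithin_mono t (fun x (hx : x ∈ Ioi t) => ne_of_gt hx))
  refine closed'.mem_of_tendsto hs ?_
  filter_upwards [Ioo_mem_nhdsGT (lt_min (by linarith) htt.2 : t < min (t + η) t₁)] with t' ht'
  exact slope_mem t' ht'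

theorem ftc_lip {a b : ℝ} (hab : a ≤ b) {M : NNReal} {u : ℝ → NState n}
    (hu : LipschitzOnWith M u (Icc a b)) (hd : ∀ᵐ t ∂(volume.restrict (Icc a b)),
      DifferentiableAt ℝ u t) (hi : IntegrableOn (deriv u) (Icc a b)) :
    ∫ t in a..b, deriv u t = u b - u a := by
  have key : ∀ e : NState n →L[ℝ] ℝ, e (∫ t in a..b, deriv u t) = e (u b - u a) := by
    intro e
    have ii : IntervalIntegrable (deriv u) volume a b := by
      rw [intervalIntegrable_iff_integrableOn_Icc_of_le hab]; exact hi
    rw [← e.intervalIntegral_comp_comm ii]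
    have hl : LipschitzOnWith (‖e‖₊ * M) (fun t => e (u t)) (uIcc a b) := by
      rw [uIcc_of_le hab]
      exact e.lipschitz.comp_lipschitzOnWith hu
    have := hl.absolutelyContinuousOnInterval.integral_deriv_eq_sub
    rw [map_sub, ← this]
    refine intervalIntegral.integral_congr_ae ?_
    rw [uIoc_of_le hab]
    have hd' := (ae_restrict_iff' measurableSet_Icc).1 hd
    filter_upwards [hd'] with t h1 h2
    have := (e.hasFDerivAt.comp_hasDerivAt t (h1 ⟨h2.1.le, h2.2⟩).hasDerivAt)
    exact this.deriv.symm
  ext i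
  · exact key ((ContinuousLinearMap.proj i).comp (ContinuousLinearMap.fst ℝ _ _))
  · exact key ((ContinuousLinearMap.proj i).comp (ContinuousLinearMap.snd ℝ _ _))

theorem closure_lemma {R t₀ t₁ : ℝ} (hR : 0 ≤ R) (ht : t₀ ≤ t₁) {u₀ u : ℝ → NState n}
    {uk : ℕ → ℝ → NState n}
    {f : ℕ → ℝ → NState n} {h : ℕ → ℝ} (hh0 : ∀ k, 0 ≤ h k) (hh : Tendsto h atTop (𝓝 0))
    (hu₀ : ContinuousOn u₀ (Iic 0))
    (hini : ∀ k, ∀ t ≤ t₀, uk k t = u₀ (t - t₀)) (initu : ∀ t ≤ t₀, u t = u₀ (t - t₀))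
    (hcuk : ∀ k, ContinuousOn (uk k) (Iic t₁))
    (hf : ∀ k, IntegrableOn (f k) (Icc t₀ t₁))
    (heq : ∀ k, ∀ t ∈ Icc t₀ t₁, uk k t = u₀ 0 + ∫ s in t₀..t, f k s)
    (hmem : ∀ k, ∀ s ∈ Icc t₀ t₁, f k s ∈ P.Fset R s (hist (uk k) (s - h k)))
    (conv : ∀ t ∈ Icc t₀ t₁, Tendsto (fun k => uk k t) atTop (𝓝 (u t))) :
    ContinuousOn u (Iic t₁) ∧ ∃ g : ℝ → NState n, IntegrableOn g (Icc t₀ t₁) ∧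
      (∀ s ∈ Icc t₀ t₁, g s ∈ P.Fset R s (hist u s)) ∧
      ∀ t ∈ Icc t₀ t₁, u t = u₀ 0 + ∫ s in t₀..t, g s := by
  obtain ⟨M, hM0, hM⟩ := P.exists_bound R t₀ t₁ hR
  have hlip : ∀ k, ∀ s ∈ Icc t₀ t₁, ∀ t ∈ Icc t₀ t₁, uk k t - uk k s = ∫ r in s..t, f k r ∧
      ‖uk k t - uk k s‖ ≤ M * |t - s| := fun k =>
    lip_of_integral (hf k) (fun s hs => hM s hs _ (cont_hist (hcuk k) (by linarith [hh0 k, hs.2])) _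
      (hmem k s hs)) (heq k)
  have hul : LipschitzOnWith ⟨M, hM0⟩ u (Icc t₀ t₁) := by
    refine LipschitzOnWith.of_dist_le_mul fun s hs t ht' => ?_
    rw [dist_eq_norm, Real.dist_eq]
    refine le_of_tendsto ((conv s hs).sub (conv t ht')).norm (Eventually.of_forall fun k => ?_)
    exact (hlip k t ht' s hs).2
  have hcu : ContinuousOn u (Iic t₁) := cont_glue ht hu₀ initu hul.continuousOn
  refine ⟨hcu, ?_⟩
  have hdiff : ∀ᵐ t ∂(volume.restrict (Icc t₀ t₁)), t ∈ Ioo t₀ t₁ ∧ DifferentiableAt ℝ u t := by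
    have h1 := hul.ae_differentiableWithinAt_real measurableSet_Icc
    have h2 : ∀ᵐ t ∂(volume.restrict (Icc t₀ t₁)), t ∈ Ioo t₀ t₁ := by
      rw [← restrict_Ioo_eq_restrict_Icc]
      exact ae_restrict_mem measurableSet_Ioo
    filter_upwards [h1, h2] with t h3 h4
    exact ⟨h4, h3.differentiableAt (Icc_mem_nhds h4.1 h4.2)⟩
  classical
  set g : ℝ → NState n := fun s => if s ∈ Ioo t₀ t₁ ∧ DifferentiableAt ℝ u s then deriv u s else
    P.H R ((s, hist u s 0), (P.up (hist u s), P.up (hist u s))) with hg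
  have gmem : ∀ s ∈ Icc t₀ t₁, g s ∈ P.Fset R s (hist u s) := by
    intro s hs
    simp only [hg]
    split_ifs with hc
    · exact P.deriv_mem ht hh0 hh hu₀ hini initu hcu hcuk hf hlip hmem conv hc.1 hc.2.hasDerivAt
    · exact ⟨_, P.up_mem_K (cont_hist hcu hs.2), rfl⟩
  have gae : deriv u =ᵐ[volume.restrict (Icc t₀ t₁)] g := by
    filter_upwards [hdiff] with t htd
    simp only [hg, if_pos htd]
  have gint : IntegrableOn g (Icc t₀ t₁) := by
    refine IntegrableOn.of_bound (by simp) ?_ M ?_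
    · exact (measurable_deriv u).aestronglyMeasurable.congr gae
    · exact (ae_restrict_iff' measurableSet_Icc).2 (Eventually.of_forall fun s hs =>
        hM s hs _ (cont_hist hcu hs.2) _ (gmem s hs))
  have dint : IntegrableOn (deriv u) (Icc t₀ t₁) := gint.congr gae.symm
  refine ⟨g, gint, gmem, fun t htt => ?_⟩
  have hsub : Icc t₀ t ⊆ Icc t₀ t₁ := Icc_subset_Icc_right htt.2
  have h1 := ftc_lip htt.1 (hul.mono hsub)
    ((ae_restrict_of_ae_restrict_of_subset hsub hdiff).mono fun _ h => h.2) (dint.mono_set hsub)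
  have h2 : ∫ s in t₀..t, g s = ∫ s in t₀..t, deriv u s := by
    refine intervalIntegral.integral_congr_ae ?_
    rw [uIoc_of_le htt.1]
    filter_upwards [(ae_restrict_iff' measurableSet_Icc).1 gae] with s h3 h4
    exact (h3 ⟨h4.1.le, h4.2.trans htt.2⟩).symm
  rw [h2, h1, initu t₀ le_rfl]
  simp

end Dat

namespace Dat

variable {n : ℕ} (P : Dat n)

/-- Single-valued selection of the right-hand side. -/
def Fsel (R s : ℝ) (w : ℝ → NState n) : NState n := P.H R ((s, w 0), (P.up w, P.up w))

theorem Fsel_mem (R s : ℝ) {w : ℝ → NState n} (hw : ContinuousOn w (Iic 0)) :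
    P.Fsel R s w ∈ P.Fset R s w := ⟨_, P.up_mem_K hw, rfl⟩

theorem Fsel_congr (R s : ℝ) {w w' : ℝ → NState n} (h : ∀ τ ≤ 0, w τ = w' τ) :
    P.Fsel R s w = P.Fsel R s w' := by
  have : P.up w = P.up w' := by
    funext p
    exact setIntegral_congr_fun measurableSet_Iic fun τ hτ => by simp only [h τ hτ]
  simp only [Fsel, this, h 0 le_rfl]

theorem measurable_Fsel (R h : ℝ) {u : ℝ → NState n} (hu : Continuous u) :
    Measurable (fun s => P.Fsel R s (hist u (s - h))) := by
  have hup : Measurable (fun s => P.up (hist u (s - h))) := by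
    refine measurable_pi_lambda _ fun p => ?_
    haveI : IsFiniteMeasure ((P.μ p).restrict (Iic 0)) := ⟨by simpa using P.hμ p⟩
    have hm : Measurable (fun q : ℝ × ℝ => chiU P.ε ((u (q.1 - h + q.2)).1 p.1.1 - P.Γ p.1.1)) := by
      refine (measurable_chiU P.ε).comp (Continuous.measurable ?_)
      fun_prop
    exact (hm.stronglyMeasurable.integral_prod_right' (ν := (P.μ p).restrict (Iic 0))).measurable
  unfold Fsel
  have h0 : Continuous (fun s => hist u (s - h) 0) := by unfold hist; fun_prop
  have h1 : StronglyMeasurable (fun s : ℝ => (s, hist u (s - h) 0)) :=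
    (continuous_id.prodMk h0).stronglyMeasurable
  have h2 := hup.stronglyMeasurable
  exact ((P.continuous_H R).comp_stronglyMeasurable (h1.prodMk (h2.prodMk h2))).measurable

theorem intervalIntegrable_Fsel {R : ℝ} (hR : 0 ≤ R) (h : ℝ) {u : ℝ → NState n} (hu : Continuous u)
    (a b : ℝ) : IntervalIntegrable (fun s => P.Fsel R s (hist u (s - h))) volume a b := by
  obtain ⟨M, hM0, hM⟩ := P.exists_bound R (min a b) (max a b) hR
  have : IntegrableOn (fun s => P.Fsel R s (hist u (s - h))) (uIcc a b) := by
    refine IntegrableOn.of_bound (by simp [uIcc]) (P.measurable_Fsel R h hu).aestronglyMeasurable M ?_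
    refine (ae_restrict_iff' measurableSet_Icc).2 (Eventually.of_forall fun s hs => ?_)
    have hc : ContinuousOn (hist u (s - h)) (Iic 0) := by
      unfold hist
      fun_prop
    exact hM s hs _ hc _ (P.Fsel_mem R s hc)
  exact this.intervalIntegrable

/-- Tonelli operator with delay `h`. -/
def Ton (R t₀ h : ℝ) (u₀ u : ℝ → NState n) : ℝ → NState n := fun t =>
  u₀ (min (t - t₀) 0) + ∫ s in t₀..(max t t₀), P.Fsel R s (hist u (s - h))

theorem continuous_init {u₀ : ℝ → NState n} (hu₀ : ContinuousOn u₀ (Iic 0)) (t₀ : ℝ) :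
    Continuous (fun t => u₀ (min (t - t₀) 0)) :=
  hu₀.comp_continuous (by fun_prop) (fun τ => mem_Iic.2 (min_le_right _ _))

theorem continuous_Ton {R : ℝ} (hR : 0 ≤ R) (t₀ h : ℝ) {u₀ u : ℝ → NState n}
    (hu₀ : ContinuousOn u₀ (Iic 0)) (hu : Continuous u) : Continuous (P.Ton R t₀ h u₀ u) := by
  unfold Ton
  refine (continuous_init hu₀ t₀).add ?_
  exact (intervalIntegral.continuous_primitive
    (fun a b => P.intervalIntegrable_Fsel hR h hu a b) t₀).comp
    (continuous_id.max continuous_const)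

/-- Tonelli iterates. -/
def Tit (R t₀ h : ℝ) (u₀ : ℝ → NState n) : ℕ → ℝ → NState n
  | 0 => fun t => u₀ (min (t - t₀) 0)
  | j + 1 => P.Ton R t₀ h u₀ (Tit R t₀ h u₀ j)

theorem continuous_Tit {R : ℝ} (hR : 0 ≤ R) (t₀ h : ℝ) {u₀ : ℝ → NState n}
    (hu₀ : ContinuousOn u₀ (Iic 0)) (j : ℕ) : Continuous (P.Tit R t₀ h u₀ j) := by
  induction j with
  | zero => exact continuous_init hu₀ t₀
  | succ j ih => exact P.continuous_Ton hR t₀ h hu₀ ih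

theorem Tit_stable (R t₀ : ℝ) {h : ℝ} (hh : 0 ≤ h) (u₀ : ℝ → NState n) (j : ℕ) :
    ∀ t ≤ t₀ + j * h, P.Tit R t₀ h u₀ (j + 1) t = P.Tit R t₀ h u₀ j t := by
  induction j with
  | zero =>
    intro t ht
    have ht : t ≤ t₀ := by simpa using ht
    simp [Tit, Ton, max_eq_right ht]
  | succ j ih =>
    intro t ht
    change P.Ton R t₀ h u₀ (P.Tit R t₀ h u₀ (j + 1)) t = P.Ton R t₀ h u₀ (P.Tit R t₀ h u₀ j) t
    unfold Ton
    congr 1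
    refine intervalIntegral.integral_congr fun s hs => ?_
    refine P.Fsel_congr R s fun τ hτ => ih _ ?_
    rw [uIcc_of_le (le_max_right _ _)] at hs
    push_cast at ht
    have : s ≤ t₀ + (j + 1) * h := hs.2.trans (max_le ht (by nlinarith [mul_nonneg (Nat.cast_nonneg (α := ℝ) j) hh]))
    linarith

theorem exists_tonelli {R t₀ t₁ h : ℝ} (hR : 0 ≤ R) (hh : 0 < h) {u₀ : ℝ → NState n}
    (hu₀ : ContinuousOn u₀ (Iic 0)) : ∃ u : ℝ → NState n, Continuous u ∧
      (∀ t ≤ t₀, u t = u₀ (t - t₀)) ∧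
      ∀ t ∈ Icc t₀ t₁, u t = u₀ 0 + ∫ s in t₀..t, P.Fsel R s (hist u (s - h)) := by
  obtain ⟨N, hN⟩ := exists_nat_ge ((t₁ - t₀) / h)
  rw [div_le_iff₀ hh] at hN
  have key : ∀ t ≤ t₁, P.Ton R t₀ h u₀ (P.Tit R t₀ h u₀ N) t = P.Tit R t₀ h u₀ N t := fun t ht =>
    P.Tit_stable R t₀ hh.le u₀ N t (by linarith)
  refine ⟨P.Tit R t₀ h u₀ N, P.continuous_Tit hR t₀ h hu₀ N, fun t ht => ?_, fun t ht => ?_⟩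
  · have h0 : ∀ j, P.Tit R t₀ h u₀ j t = u₀ (t - t₀) := by
      intro j
      cases j with
      | zero => simp [Tit, min_eq_left (sub_nonpos.2 ht)]
      | succ j => simp [Tit, Ton, max_eq_right ht, min_eq_left (sub_nonpos.2 ht)]
    exact h0 N
  · rw [← key t ht.2]
    simp only [Ton]
    rw [max_eq_left ht.1, min_eq_right (sub_nonneg.2 ht.1)]

theorem exists_trunc {R t₀ t₁ : ℝ} (hR : 0 ≤ R) (ht : t₀ ≤ t₁) {u₀ : ℝ → NState n}
    (hu₀ : ContinuousOn u₀ (Iic 0)) : ∃ u : ℝ → NState n, (∀ t ≤ t₀, u t = u₀ (t - t₀)) ∧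
      ContinuousOn u (Iic t₁) ∧ ∃ g : ℝ → NState n, IntegrableOn g (Icc t₀ t₁) ∧
      (∀ s ∈ Icc t₀ t₁, g s ∈ P.Fset R s (hist u s)) ∧
      ∀ t ∈ Icc t₀ t₁, u t = u₀ 0 + ∫ s in t₀..t, g s := by
  have hpos : ∀ k : ℕ, (0 : ℝ) < 1 / ((k : ℝ) + 1) := fun k => Nat.one_div_pos_of_nat
  choose uk ck ik ek using fun k : ℕ => P.exists_tonelli (t₀ := t₀) (t₁ := t₁) hR (hpos k) hu₀
  set f : ℕ → ℝ → NState n := fun k s => P.Fsel R s (hist (uk k) (s - 1 / ((k : ℝ) + 1))) with hf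
  obtain ⟨M, hM0, hM⟩ := P.exists_bound R t₀ t₁ hR
  have fint : ∀ k, IntegrableOn (f k) (Icc t₀ t₁) := fun k => by
    rw [← intervalIntegrable_iff_integrableOn_Icc_of_le ht]
    exact P.intervalIntegrable_Fsel hR _ (ck k) _ _
  have fmem : ∀ k, ∀ s ∈ Icc t₀ t₁, f k s ∈ P.Fset R s (hist (uk k) (s - 1 / ((k : ℝ) + 1))) :=
    fun k s hs => P.Fsel_mem R s (cont_hist (t₁ := s) (ck k).continuousOn (by linarith [hpos k]))
  have hlip := fun k => lip_of_integral (fint k) (fun s hs => hM s hs _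
    (cont_hist (t₁ := s) (ck k).continuousOn (by linarith [hpos k])) _ (fmem k s hs)) (ek k)
  have h0 : t₀ ∈ Icc t₀ t₁ := ⟨le_rfl, ht⟩
  let G : ℕ → BoundedContinuousFunction (Icc t₀ t₁) (NState n) := fun k =>
    BoundedContinuousFunction.mkOfCompact ⟨fun t => uk k t.1, (ck k).comp continuous_subtype_val⟩
  have hG : ∀ k t, G k t = uk k t.1 := fun k t => rfl
  have hcomp : IsCompact (closure (range G)) := by
    refine BoundedContinuousFunction.arzela_ascoli
      (Metric.closedBall (u₀ 0) (M * (t₁ - t₀))) (isCompact_closedBall _ _) _ ?_ ?_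
    · rintro _ x ⟨k, rfl⟩
      rw [hG, mem_closedBall_iff_norm]
      have h1 := (hlip k t₀ h0 x.1 x.2).2
      rw [ik k t₀ le_rfl, sub_self] at h1
      refine h1.trans (mul_le_mul_of_nonneg_left ?_ hM0)
      rw [abs_of_nonneg (sub_nonneg.2 x.2.1)]
      linarith [x.2.2]
    · refine UniformEquicontinuous.equicontinuous
        (LipschitzWith.uniformEquicontinuous _ ⟨M, hM0⟩ ?_)
      rintro ⟨_, k, rfl⟩
      refine LipschitzWith.of_dist_le_mul fun x y => ?_
      rw [dist_eq_norm, Subtype.dist_eq, Real.dist_eq]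
      exact (hlip k y.1 y.2 x.1 x.2).2
  obtain ⟨L, -, φ, hφ, hlim⟩ := hcomp.tendsto_subseq (x := G) (fun k => subset_closure ⟨k, rfl⟩)
  have hpt : ∀ x, Tendsto (fun k => uk (φ k) x.1) atTop (𝓝 (L x)) := by
    intro x
    have := (BoundedContinuousFunction.lipschitz_eval_const (β := NState n) x).continuous.tendsto L
    exact this.comp hlim
  classical
  let u : ℝ → NState n := fun t => if h : t ∈ Icc t₀ t₁ then L ⟨t, h⟩ else u₀ (t - t₀)
  have conv : ∀ t ∈ Icc t₀ t₁, Tendsto (fun k => uk (φ k) t) atTop (𝓝 (u t)) := by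
    intro t ht'
    simp only [u, dif_pos ht']
    exact hpt ⟨t, ht'⟩
  have initu : ∀ t ≤ t₀, u t = u₀ (t - t₀) := by
    intro t ht'
    rcases ht'.lt_or_eq with h | h
    · have : t ∉ Icc t₀ t₁ := fun hc => absurd hc.1 (not_le.2 h)
      simp only [u, dif_neg this]
    · subst h
      refine tendsto_nhds_unique (conv t h0) ?_
      simp only [ik _ t le_rfl]
      exact tendsto_const_nhds
  refine ⟨u, initu, ?_⟩
  exact P.closure_lemma hR ht (uk := fun k => uk (φ k)) (f := fun k => f (φ k))
    (h := fun k => 1 / ((φ k : ℝ) + 1)) (fun k => (hpos _).le)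
    (tendsto_one_div_add_atTop_nhds_zero_nat.comp hφ.tendsto_atTop) hu₀ (fun k => ik _) initu
    (fun k => (ck _).continuousOn) (fun k => fint _) (fun k => ek _) (fun k => fmem _) conv

end Dat

namespace Dat

variable {n : ℕ} (P : Dat n)

theorem diss {t₀ t : ℝ} (ht : t₀ ≤ t) {y φ ρ : ℝ → ℝ} (hy : ContinuousOn y (Icc t₀ t))
    (hφ : IntegrableOn φ (Icc t₀ t)) (hρ : ContinuousOn ρ (Icc t₀ t))
    (hρ0 : ∀ s ∈ Icc t₀ t, 0 ≤ ρ s)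
    (heq : ∀ s ∈ Icc t₀ t, y s = y t₀ + ∫ r in t₀..s, φ r)
    (hle : ∀ s ∈ Icc t₀ t, 0 < y s → φ s ≤ ρ s) : y t ≤ |y t₀| + ∫ r in t₀..t, ρ r := by
  have hρi : IntegrableOn ρ (Icc t₀ t) := hρ.integrableOn_Icc
  have ii : ∀ {g : ℝ → ℝ}, IntegrableOn g (Icc t₀ t) → ∀ x ∈ Icc t₀ t, ∀ y ∈ Icc t₀ t,
      IntervalIntegrable g volume x y := fun hg x hx y hy =>
    (hg.mono_set (uIcc_subset_Icc hx hy)).intervalIntegrable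
  have m0 : t₀ ∈ Icc t₀ t := ⟨le_rfl, ht⟩
  have mt : t ∈ Icc t₀ t := ⟨ht, le_rfl⟩
  have step : ∀ s ∈ Icc t₀ t, (∀ r ∈ Ioo s t, 0 < y r) → y t ≤ y s + ∫ r in t₀..t, ρ r := by
    intro s hs hpos
    have e1 : y t = y s + ∫ r in s..t, φ r := by
      rw [heq t mt, heq s hs, add_assoc,
        intervalIntegral.integral_add_adjacent_intervals (ii hφ _ m0 _ hs) (ii hφ _ hs _ mt)]
    have e2 : ∫ r in s..t, φ r ≤ ∫ r in s..t, ρ r :=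
      intervalIntegral.integral_mono_on_of_le_Ioo hs.2 (ii hφ _ hs _ mt) (ii hρi _ hs _ mt)
        fun r hr => hle r ⟨hs.1.trans hr.1.le, hr.2.le⟩ (hpos r hr)
    have e3 : ∫ r in t₀..t, ρ r = (∫ r in t₀..s, ρ r) + ∫ r in s..t, ρ r :=
      (intervalIntegral.integral_add_adjacent_intervals (ii hρi _ m0 _ hs) (ii hρi _ hs _ mt)).symm
    have e4 : 0 ≤ ∫ r in t₀..s, ρ r :=
      intervalIntegral.integral_nonneg hs.1 fun r hr => hρ0 r ⟨hr.1, hr.2.trans hs.2⟩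
    linarith
  have hZ : IsCompact (Icc t₀ t ∩ y ⁻¹' Iic 0) :=
    isCompact_Icc.of_isClosed_subset (hy.preimage_isClosed_of_isClosed isClosed_Icc isClosed_Iic)
      inter_subset_left
  rcases (Icc t₀ t ∩ y ⁻¹' Iic 0).eq_empty_or_nonempty with h | h
  · have := step t₀ m0 fun r hr => by
      by_contra hc
      have : r ∈ Icc t₀ t ∩ y ⁻¹' Iic 0 := ⟨⟨hr.1.le, hr.2.le⟩, not_lt.1 hc⟩
      rw [h] at this
      exact this
    linarith [le_abs_self (y t₀)]
  · obtain ⟨s, hs, hmax⟩ := hZ.exists_isGreatest h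
    have := step s hs.1 fun r hr => by
      by_contra hc
      have : r ∈ Icc t₀ t ∩ y ⁻¹' Iic 0 := ⟨⟨hs.1.1.trans hr.1.le, hr.2.le⟩, not_lt.1 hc⟩
      exact absurd (hmax this) (not_le.2 hr.1)
    have h0 : y s ≤ 0 := hs.2
    linarith [abs_nonneg (y t₀)]

theorem tot_nonneg (p : IdxZ n) : 0 ≤ P.tot p := measureReal_nonneg

theorem norm_Tm_le : ∃ C : ℝ, 0 ≤ C ∧ ∀ y : NState n, ∀ m ∈ Icc 0 P.tot ×ˢ Icc 0 P.tot,
    ‖P.Tm y m‖ ≤ C * (1 + ‖y‖) := by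
  set Q := ∑ p : IdxZ n, (1 + |P.c p| + |P.d p|) * P.tot p with hQ
  have t0 : ∀ p : IdxZ n, 0 ≤ (1 + |P.c p| + |P.d p|) * P.tot p := fun p =>
    mul_nonneg (by positivity) (P.tot_nonneg p)
  have hp : ∀ p, (1 + |P.c p| + |P.d p|) * P.tot p ≤ Q := fun p =>
    Finset.single_le_sum (f := fun p => (1 + |P.c p| + |P.d p|) * P.tot p) (fun p _ => t0 p)
      (Finset.mem_univ p)
  have Q0 : 0 ≤ Q := Finset.sum_nonneg fun p _ => t0 p
  refine ⟨(n + 1) * Q, by positivity, ?_⟩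
  rintro y m ⟨⟨h1, h2⟩, ⟨h3, h4⟩⟩
  have hy := norm_nonneg y
  have b1 : ∀ p, |(y.2 p - P.c p) * m.1 p| ≤ Q * (1 + ‖y‖) := by
    intro p
    rw [abs_mul, abs_of_nonneg (h1 p)]
    have e1 : |y.2 p - P.c p| ≤ (1 + |P.c p| + |P.d p|) * (1 + ‖y‖) := by
      refine (abs_sub _ _).trans ?_
      have := norm2_le y p
      nlinarith [abs_nonneg (P.c p), abs_nonneg (P.d p), mul_nonneg (abs_nonneg (P.c p)) hy,
        mul_nonneg (abs_nonneg (P.d p)) hy]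
    calc |y.2 p - P.c p| * m.1 p ≤ ((1 + |P.c p| + |P.d p|) * (1 + ‖y‖)) * P.tot p :=
          mul_le_mul e1 (h2 p) (h1 p) (by positivity)
      _ = ((1 + |P.c p| + |P.d p|) * P.tot p) * (1 + ‖y‖) := by ring
      _ ≤ Q * (1 + ‖y‖) := mul_le_mul_of_nonneg_right (hp p) (by positivity)
  have b2 : ∀ p, |(P.d p * max (y.1 p.1.2) 0) * m.2 p| ≤ Q * (1 + ‖y‖) := by
    intro p
    rw [abs_mul, abs_of_nonneg (h3 p)]
    have e1 : |P.d p * max (y.1 p.1.2) 0| ≤ (1 + |P.c p| + |P.d p|) * (1 + ‖y‖) := by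
      rw [abs_mul, abs_of_nonneg (le_max_right (y.1 p.1.2) 0)]
      have h5 : max (y.1 p.1.2) 0 ≤ ‖y‖ := max_le ((le_abs_self _).trans (norm1_le y _)) hy
      have h6 := mul_le_mul_of_nonneg_left h5 (abs_nonneg (P.d p))
      nlinarith [abs_nonneg (P.c p), abs_nonneg (P.d p), mul_nonneg (abs_nonneg (P.c p)) hy]
    calc |P.d p * max (y.1 p.1.2) 0| * m.2 p ≤ ((1 + |P.c p| + |P.d p|) * (1 + ‖y‖)) * P.tot p :=
          mul_le_mul e1 (h4 p) (h3 p) (by positivity)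
      _ = ((1 + |P.c p| + |P.d p|) * P.tot p) * (1 + ‖y‖) := by ring
      _ ≤ Q * (1 + ‖y‖) := mul_le_mul_of_nonneg_right (hp p) (by positivity)
  have q0 : 0 ≤ Q * (1 + ‖y‖) := by positivity
  refine norm_le_of (by positivity) (fun i => ?_) (fun p => ?_)
  · simp only [Tm]
    refine (Finset.abs_sum_le_sum_abs _ _).trans ?_
    have : ∀ k ∈ (Finset.univ : Finset (Fin n)), |if h : k ≠ i then
        (y.2 ⟨(k, i), h⟩ - P.c ⟨(k, i), h⟩) * m.1 ⟨(k, i), h⟩ else 0| ≤ Q * (1 + ‖y‖) := by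
      intro k _
      split_ifs with h
      · exact b1 _
      · simpa using q0
    refine (Finset.sum_le_card_nsmul _ _ _ this).trans ?_
    simp only [Finset.card_univ, Fintype.card_fin, nsmul_eq_mul]
    nlinarith
  · refine (b2 p).trans ?_
    have : (0 : ℝ) ≤ n := Nat.cast_nonneg n
    nlinarith [mul_nonneg this q0]

theorem cl_pos {R x : ℝ} (hR : 0 ≤ R) (hx : 0 ≤ x) : 0 ≤ cl R x :=
  le_max_of_le_right (le_min hR hx)

theorem cl_neg {R x : ℝ} (hR : 0 ≤ R) (hx : x ≤ 0) : cl R x ≤ 0 :=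
  max_le (by linarith) (min_le_of_right_le hx)

theorem norm_clV_le' {R : ℝ} (hR : 0 ≤ R) (y : NState n) : ‖clV R y‖ ≤ ‖y‖ := by
  rcases le_total ‖y‖ R with h | h
  · rw [clV_of_norm_le h]
  · exact (norm_clV_le hR y).trans h

/-- One-sided growth. -/
theorem growth (t₀ t₁ : ℝ) : ∃ C : ℝ, 0 ≤ C ∧ ∀ R : ℝ, 0 ≤ R → ∀ s ∈ Icc t₀ t₁,
    ∀ w : ℝ → NState n, ContinuousOn w (Iic 0) → ∀ v ∈ P.Fset R s w,
      (∀ i, (0 < (w 0).1 i → v.1 i ≤ C * (1 + ‖w 0‖)) ∧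
        (0 < -(w 0).1 i → -v.1 i ≤ C * (1 + ‖w 0‖))) ∧
      (∀ i, (0 < (w 0).2 i → v.2 i ≤ C * (1 + ‖w 0‖)) ∧
        (0 < -(w 0).2 i → -v.2 i ≤ C * (1 + ‖w 0‖))) := by
  obtain ⟨C1, hC1, hT⟩ := P.norm_Tm_le
  obtain ⟨C0, hC0⟩ := (isCompact_Icc (a := t₀) (b := t₁)).exists_bound_of_continuousOn
    P.continuous_stim.continuousOn
  refine ⟨C1 + |C0|, by positivity, ?_⟩
  rintro R hR s hs w hw _ ⟨m, ⟨hm1, hm2⟩, rfl⟩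
  set r : NState n := P.Tm (clV R (w 0)) m + stimT P.Istim s with hr
  have hH : P.H R ((s, w 0), m) = P.Dy (clV R (w 0)) + r := by
    simp only [H, hr, add_assoc]
  have hrn : ‖r‖ ≤ (C1 + |C0|) * (1 + ‖w 0‖) := by
    refine (norm_add_le _ _).trans ?_
    have h1 := hT (clV R (w 0)) m
      ⟨⟨(P.lo_nonneg w).trans hm1.1, hm1.2.trans (P.up_le_tot hw)⟩,
        ⟨(P.lo_nonneg w).trans hm2.1, hm2.2.trans (P.up_le_tot hw)⟩⟩
    have h2 := hC0 s hs
    have h3 := norm_clV_le' hR (w 0)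
    have h4 : C1 * (1 + ‖clV R (w 0)‖) ≤ C1 * (1 + ‖w 0‖) := by gcongr
    have h5 : |C0| * 1 ≤ |C0| * (1 + ‖w 0‖) := by
      gcongr
      linarith [norm_nonneg (w 0)]
    linarith [le_abs_self C0]
  simp only [hH]
  refine ⟨fun i => ⟨fun hp => ?_, fun hp => ?_⟩, fun i => ⟨fun hp => ?_, fun hp => ?_⟩⟩
  · have h1 := mul_nonneg (P.hA0 i (cl R ((w 0).1 i))) (cl_pos hR hp.le)
    have h2 := (abs_le.1 ((norm1_le r i).trans hrn))
    simp only [Prod.fst_add, Pi.add_apply, Dy, clV]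
    linarith [h2.2]
  · have h1 := mul_nonneg_of_nonpos_of_nonpos (neg_nonpos.2 (P.hA0 i (cl R ((w 0).1 i))))
      (cl_neg hR (by linarith : (w 0).1 i ≤ 0))
    have h2 := (abs_le.1 ((norm1_le r i).trans hrn))
    simp only [Prod.fst_add, Pi.add_apply, Dy, clV]
    linarith [h2.1]
  · have h1 := mul_nonneg (P.hB0 i (cl R ((w 0).2 i))) (cl_pos hR hp.le)
    have h2 := (abs_le.1 ((norm2_le r i).trans hrn))
    simp only [Prod.snd_add, Pi.add_apply, Dy, clV]
    linarith [h2.2]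
  · have h1 := mul_nonneg_of_nonpos_of_nonpos (neg_nonpos.2 (P.hB0 i (cl R ((w 0).2 i))))
      (cl_neg hR (by linarith : (w 0).2 i ≤ 0))
    have h2 := (abs_le.1 ((norm2_le r i).trans hrn))
    simp only [Prod.snd_add, Pi.add_apply, Dy, clV]
    linarith [h2.1]

/-- A priori bound. -/
theorem apriori {t₀ t₁ C : ℝ} {u g : ℝ → NState n} (hC0 : 0 ≤ C)
    (hu : ContinuousOn u (Icc t₀ t₁)) (hg : IntegrableOn g (Icc t₀ t₁))
    (heq : ∀ t ∈ Icc t₀ t₁, u t = u t₀ + ∫ s in t₀..t, g s)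
    (hC : ∀ s ∈ Icc t₀ t₁, 
      (∀ i, (0 < (u s).1 i → (g s).1 i ≤ C * (1 + ‖u s‖)) ∧
        (0 < -(u s).1 i → -(g s).1 i ≤ C * (1 + ‖u s‖))) ∧
      (∀ i, (0 < (u s).2 i → (g s).2 i ≤ C * (1 + ‖u s‖)) ∧
        (0 < -(u s).2 i → -(g s).2 i ≤ C * (1 + ‖u s‖)))) :
    ∀ t ∈ Icc t₀ t₁, ‖u t‖ ≤ (‖u t₀‖ + 2) * Real.exp (C * (t - t₀)) - 1 := by
  set β : ℝ → ℝ := fun t => (‖u t₀‖ + 2) * Real.exp (C * (t - t₀)) - 1 with hβ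
  have cβ : Continuous β := by fun_prop
  have hgint : ∀ t, ∫ s in t₀..t, C * (1 + β s) = β t - ‖u t₀‖ - 1 := by
    intro t
    have hd : ∀ s ∈ uIcc t₀ t, HasDerivAt β (C * (1 + β s)) s := by
      intro s _
      have h1 : HasDerivAt (fun s => C * (s - t₀)) C s := by
        simpa using ((hasDerivAt_id s).sub_const t₀).const_mul C
      have h2 := (h1.exp.const_mul (‖u t₀‖ + 2)).sub_const 1
      refine h2.congr_deriv ?_
      simp only [hβ]
      ring
    rw [intervalIntegral.integral_eq_sub_of_hasDerivAt hd
      ((by fun_prop : Continuous fun s => C * (1 + β s)).intervalIntegrable _ _)]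
    simp only [hβ]
    simp
    ring
  have key : ∀ t ∈ Icc t₀ t₁, (∀ s ∈ Ico t₀ t, ‖u s‖ ≤ β s) → ‖u t‖ ≤ β t - 1 := by
    intro t ht hs
    have hsub : Icc t₀ t ⊆ Icc t₀ t₁ := Icc_subset_Icc_right ht.2
    have cρ : ContinuousOn (fun s => C * (1 + ‖u s‖)) (Icc t₀ t) :=
      continuousOn_const.mul (continuousOn_const.add (hu.mono hsub).norm)
    have iρ : ∫ s in t₀..t, C * (1 + ‖u s‖) ≤ β t - ‖u t₀‖ - 1 := by
      rw [← hgint t]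
      refine intervalIntegral.integral_mono_on_of_le_Ioo ht.1
        (cρ.intervalIntegrable_of_Icc ht.1)
        ((by fun_prop : Continuous fun s => C * (1 + β s)).intervalIntegrable _ _) fun s hs' => ?_
      have := hs s ⟨hs'.1.le, hs'.2⟩
      gcongr
    have i0 : 0 ≤ ∫ s in t₀..t, C * (1 + ‖u s‖) :=
      intervalIntegral.integral_nonneg ht.1 fun s _ => by positivity
    have comp : ∀ e : NState n →L[ℝ] ℝ, |e (u t₀)| ≤ ‖u t₀‖ →
        (∀ s ∈ Icc t₀ t₁, 0 < e (u s) → e (g s) ≤ C * (1 + ‖u s‖)) → e (u t) ≤ β t - 1 := by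
      intro e he hle
      have := diss ht.1 (y := fun s => e (u s)) (φ := fun s => e (g s))
        (ρ := fun s => C * (1 + ‖u s‖)) (e.continuous.comp_continuousOn (hu.mono hsub))
        (e.integrable_comp (hg.mono_set hsub)) cρ (fun s _ => by positivity)
        (fun s hs => by
          rw [heq s (hsub hs), map_add, e.intervalIntegral_comp_comm]
          exact (hg.mono_set (uIcc_subset_Icc ⟨le_rfl, hs.1.trans (hs.2.trans ht.2)⟩
            (hsub hs))).intervalIntegrable)
        (fun s hs => hle s (hsub hs))
      linarith
    have hβ1 : 0 ≤ β t - 1 := by linarith [norm_nonneg (u t₀)]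
    let e1 : Fin n → NState n →L[ℝ] ℝ := fun i =>
      (ContinuousLinearMap.proj i).comp (ContinuousLinearMap.fst ℝ _ _)
    let e2 : IdxZ n → NState n →L[ℝ] ℝ := fun i =>
      (ContinuousLinearMap.proj i).comp (ContinuousLinearMap.snd ℝ _ _)
    refine norm_le_of hβ1 (fun i => ?_) (fun i => ?_)
    · rw [abs_le]
      constructor
      · have := comp (-(e1 i)) (by simpa [e1] using norm1_le (u t₀) i)
          (fun s hs => by simpa [e1] using ((hC s hs).1 i).2)
        have : -(u t).1 i ≤ β t - 1 := by simpa [e1] using this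
        linarith
      · exact comp (e1 i) (norm1_le (u t₀) i) (fun s hs => ((hC s hs).1 i).1)
    · rw [abs_le]
      constructor
      · have := comp (-(e2 i)) (by simpa [e2] using norm2_le (u t₀) i)
          (fun s hs => by simpa [e2] using ((hC s hs).2 i).2)
        have : -(u t).2 i ≤ β t - 1 := by simpa [e2] using this
        linarith
      · exact comp (e2 i) (norm2_le (u t₀) i) (fun s hs => ((hC s hs).2 i).1)
  by_contra hcon
  push Not at hcon
  obtain ⟨t, ht, hbt⟩ := hcon
  have cont : ContinuousOn (fun s => ‖u s‖ - β s) (Icc t₀ t₁) := hu.norm.sub cβ.continuousOn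
  have hZ : IsCompact (Icc t₀ t₁ ∩ (fun s => ‖u s‖ - β s) ⁻¹' Ici 0) :=
    isCompact_Icc.of_isClosed_subset (cont.preimage_isClosed_of_isClosed isClosed_Icc isClosed_Ici)
      inter_subset_left
  obtain ⟨s, hs, hmin⟩ := hZ.exists_isLeast ⟨t, ht, by
    have : β t < ‖u t‖ := hbt
    simp only [mem_preimage, mem_Ici]; linarith⟩
  have h1 := key s hs.1 fun r hr => by
    by_contra hc
    have : r ∈ Icc t₀ t₁ ∩ (fun s => ‖u s‖ - β s) ⁻¹' Ici 0 :=
      ⟨⟨hr.1, hr.2.le.trans hs.1.2⟩, by simp only [mem_preimage, mem_Ici]; linarith⟩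
    exact absurd (hmin this) (not_le.2 hr.2)
  have h2 : 0 ≤ ‖u s‖ - β s := hs.2
  linarith

end Dat

namespace Dat

variable {n : ℕ} (P : Dat n)

/-- Solutions for the data bundle. -/
abbrev Sol (t₀ t₁ : ℝ) (u₀ u : ℝ → NState n) : Prop :=
  IsIncSolOn P.ε P.A P.B P.μ P.c P.d P.Γ P.Istim t₀ t₁ u₀ u

/-- Attainability sets for the data bundle. -/
abbrev att (t t₀ : ℝ) (u₀ : ℝ → NState n) : Set (ℝ → NState n) :=
  attain P.ε P.A P.B P.μ P.c P.d P.Γ P.Istim t t₀ u₀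

/-- Truncated solutions. -/
def TSol (R t₀ t₁ : ℝ) (u₀ u : ℝ → NState n) : Prop :=
  (∀ t ≤ t₀, u t = u₀ (t - t₀)) ∧ ContinuousOn u (Iic t₁) ∧
    ∃ g : ℝ → NState n, IntegrableOn g (Icc t₀ t₁) ∧
      (∀ s ∈ Icc t₀ t₁, g s ∈ P.Fset R s (hist u s)) ∧
      ∀ t ∈ Icc t₀ t₁, u t = u₀ 0 + ∫ s in t₀..t, g s

theorem Fset_congr (R s : ℝ) {w w' : ℝ → NState n} (h : ∀ τ ≤ 0, w τ = w' τ) :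
    P.Fset R s w = P.Fset R s w' := by
  have h1 : P.up w = P.up w' := by
    funext p
    exact setIntegral_congr_fun measurableSet_Iic fun τ hτ => by simp only [h τ hτ]
  have h2 : P.lo w = P.lo w' := by
    funext p
    exact setIntegral_congr_fun measurableSet_Iic fun τ hτ => by simp only [h τ hτ]
  simp only [Fset, K, h1, h2, h 0 le_rfl]

theorem uIoc_sub {t₀ t₁ t s : ℝ} (ht : t ∈ Icc t₀ t₁) (hs : s ∈ uIcc t₀ t) : s ∈ Icc t₀ t₁ := by
  rw [uIcc_of_le ht.1] at hs
  exact ⟨hs.1, hs.2.trans ht.2⟩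

theorem tsol_of_sol {R t₀ t₁ : ℝ} (ht : t₀ ≤ t₁) {u₀ u : ℝ → NState n}
    (hu₀ : ContinuousOn u₀ (Iic 0)) (hR : ∀ s ∈ Icc t₀ t₁, ‖u s‖ ≤ R) (h : P.Sol t₀ t₁ u₀ u) :
    P.TSol R t₀ t₁ u₀ u := by
  obtain ⟨hi, hc, S, hS, hgint, heq⟩ := h
  have hini : ∀ t ≤ t₀, u t = u₀ (t - t₀) := fun t h => by
    rw [← hi (t - t₀) (by linarith)]
    congr 1
    ring
  have hcu := cont_glue ht hu₀ hini hc
  refine ⟨hini, hcu, _, hgint, fun s hs => ?_, heq⟩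
  exact (P.mem_Fset_iff (cont_hist hcu hs.2) (by simpa [hist] using hR s hs) _).2 ⟨_, hS s hs, rfl⟩

theorem sol_of_tsol {R t₀ t₁ : ℝ} {u₀ u : ℝ → NState n}
    (hR : ∀ s ∈ Icc t₀ t₁, ‖u s‖ ≤ R) (h : P.TSol R t₀ t₁ u₀ u) :
    P.Sol t₀ t₁ u₀ u := by
  obtain ⟨hini, hcu, g, hgint, hg, heq⟩ := h
  have key : ∀ s ∈ Icc t₀ t₁, ∃ S ∈ Xset P.ε P.μ P.c P.d P.Γ (hist u s),
      g s = decayT P.A P.B (hist u s) + S + stimT P.Istim s := fun s hs =>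
    (P.mem_Fset_iff (cont_hist hcu hs.2) (by simpa [hist] using hR s hs) _).1 (hg s hs)
  choose! S hS1 hS2 using key
  refine ⟨fun s hs => ?_, hcu.mono Icc_subset_Iic_self, S, hS1, ?_, fun t ht => ?_⟩
  · rw [hini _ (by linarith)]
    congr 1
    ring
  · exact hgint.congr_fun hS2 measurableSet_Icc
  · rw [heq t ht]
    congr 1
    exact intervalIntegral.integral_congr fun s hs => hS2 s (uIoc_sub ht hs)

theorem exists_R {t₀ t₁ : ℝ} {u : ℝ → NState n} (hc : ContinuousOn u (Icc t₀ t₁)) :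
    ∃ R, ∀ s ∈ Icc t₀ t₁, ‖u s‖ ≤ R :=
  isCompact_Icc.exists_bound_of_continuousOn hc

theorem att_nonempty {t₀ t₁ : ℝ} (ht : t₀ ≤ t₁) {u₀ : ℝ → NState n}
    (hu₀ : ContinuousOn u₀ (Iic 0)) : (P.att t₁ t₀ u₀).Nonempty := by
  obtain ⟨C, hC0, hC⟩ := P.growth t₀ t₁
  set R : ℝ := (‖u₀ 0‖ + 2) * Real.exp (C * (t₁ - t₀)) - 1 with hRd
  have h1 : 1 ≤ Real.exp (C * (t₁ - t₀)) :=
    Real.one_le_exp (mul_nonneg hC0 (by linarith))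
  have hR : 0 ≤ R := by nlinarith [norm_nonneg (u₀ 0)]
  obtain ⟨u, hi, hc, g, hgint, hg, heq⟩ := P.exists_trunc hR ht hu₀
  have e0 : u t₀ = u₀ 0 := by simpa using hi t₀ le_rfl
  have hap := apriori hC0 (hc.mono Icc_subset_Iic_self) hgint (by rw [e0]; exact heq)
    (fun s hs => by
      have := hC R hR s hs _ (cont_hist hc hs.2) _ (hg s hs)
      simpa only [hist, add_zero] using this)
  refine ⟨_, u, P.sol_of_tsol (R := R) (fun s hs => (hap s hs).trans ?_) ⟨hi, hc, g, hgint, hg, heq⟩,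
    rfl⟩
  rw [e0, hRd]
  have h2 : Real.exp (C * (s - t₀)) ≤ Real.exp (C * (t₁ - t₀)) :=
    Real.exp_le_exp.2 (mul_le_mul_of_nonneg_left (by linarith [hs.2]) hC0)
  have := mul_le_mul_of_nonneg_left h2 (by positivity : (0 : ℝ) ≤ ‖u₀ 0‖ + 2)
  linarith

theorem att_self {t₀ : ℝ} {u₀ : ℝ → NState n}
    (hu₀ : ContinuousOn u₀ (Iic 0)) (hcl : ∀ s ≥ (0 : ℝ), u₀ s = u₀ 0) :
    P.att t₀ t₀ u₀ = {u₀} := by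
  refine eq_singleton_iff_nonempty_unique_mem.2 ⟨P.att_nonempty le_rfl hu₀, ?_⟩
  rintro _ ⟨u, ⟨hi, -⟩, rfl⟩
  funext s
  simp only [clampHist]
  rw [hi _ (min_le_right _ _)]
  rcases le_total s 0 with h | h
  · rw [min_eq_left h]
  · rw [min_eq_right h, hcl s h]

theorem cont_clamp {t₁ : ℝ} {u : ℝ → NState n} (hc : ContinuousOn u (Iic t₁)) :
    ContinuousOn (clampHist u t₁) (Iic 0) := by
  refine hc.comp (f := fun s => t₁ + min s 0) (by fun_prop) fun s _ => ?_
  exact mem_Iic.2 (by linarith [min_le_right s 0])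

theorem tsol_restrict {R t₀ t₁ t₂ : ℝ} (h12 : t₁ ≤ t₂) {u₀ u : ℝ → NState n}
    (h : P.TSol R t₀ t₂ u₀ u) : P.TSol R t₀ t₁ u₀ u := by
  obtain ⟨hi, hc, g, hgint, hg, heq⟩ := h
  have hs : Icc t₀ t₁ ⊆ Icc t₀ t₂ := Icc_subset_Icc_right h12
  exact ⟨hi, hc.mono (Iic_subset_Iic.2 h12), g, hgint.mono_set hs, fun s h => hg s (hs h),
    fun s h => heq s (hs h)⟩

theorem tsol_shift {R t₀ t₁ t₂ : ℝ} (h01 : t₀ ≤ t₁) (h12 : t₁ ≤ t₂) {u₀ u : ℝ → NState n}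
    (h : P.TSol R t₀ t₂ u₀ u) : P.TSol R t₁ t₂ (clampHist u t₁) u := by
  obtain ⟨hi, hc, g, hgint, hg, heq⟩ := h
  have hs : Icc t₁ t₂ ⊆ Icc t₀ t₂ := Icc_subset_Icc_left h01
  refine ⟨fun t ht => ?_, hc, g, hgint.mono_set hs, fun s h => hg s (hs h), fun t ht => ?_⟩
  · simp only [clampHist]
    rw [min_eq_left (by linarith)]
    congr 1
    ring
  · have hi1 : IntervalIntegrable g volume t₀ t₁ :=
      (intervalIntegrable_iff_integrableOn_Icc_of_le h01).2
        (hgint.mono_set (Icc_subset_Icc_right h12))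
    have hi2 : IntervalIntegrable g volume t₁ t :=
      (intervalIntegrable_iff_integrableOn_Icc_of_le ht.1).2
        (hgint.mono_set (Icc_subset_Icc h01 ht.2))
    simp only [clampHist, min_self, add_zero]
    rw [heq t (hs ht), heq t₁ ⟨h01, h12⟩, ← intervalIntegral.integral_add_adjacent_intervals hi1 hi2,
      add_assoc]

theorem tsol_glue {R t₀ t₁ t₂ : ℝ} (h01 : t₀ ≤ t₁) (h12 : t₁ ≤ t₂) {u₀ u u' : ℝ → NState n}
    (h : P.TSol R t₀ t₁ u₀ u) (h' : P.TSol R t₁ t₂ (clampHist u t₁) u') :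
    P.TSol R t₀ t₂ u₀ u' := by
  obtain ⟨hi, hc, g, hgint, hg, heq⟩ := h
  obtain ⟨hi', hc', g', hgint', hg', heq'⟩ := h'
  have agree : ∀ t ≤ t₁, u' t = u t := fun t ht => by
    rw [hi' t ht]
    simp only [clampHist]
    rw [min_eq_left (by linarith)]
    congr 1
    ring
  classical
  set G : ℝ → NState n := fun s => if s ≤ t₁ then g s else g' s with hG
  have G1 : ∀ s ≤ t₁, g s = G s := fun s hs => by simp only [hG, if_pos hs]
  have G2 : ∀ s, t₁ < s → g' s = G s := fun s hs => by simp only [hG, if_neg (not_le.2 hs)]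
  have I1 : IntegrableOn G (Icc t₀ t₁) :=
    hgint.congr_fun (fun s hs => G1 s hs.2) measurableSet_Icc
  have I2 : IntegrableOn G (Ioc t₁ t₂) :=
    (hgint'.mono_set Ioc_subset_Icc_self).congr_fun (fun s hs => G2 s hs.1) measurableSet_Ioc
  have I : IntegrableOn G (Icc t₀ t₂) := by
    rw [← Icc_union_Ioc_eq_Icc h01 h12]
    exact I1.union I2
  have eq1 : ∀ t ∈ Icc t₀ t₁, u' t = u₀ 0 + ∫ s in t₀..t, G s := fun t ht => by
    rw [agree t ht.2, heq t ht]
    congr 1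
    exact intervalIntegral.integral_congr fun s hs => G1 s (uIoc_sub ht hs).2
  refine ⟨fun t ht => ?_, hc', G, I, fun s hs => ?_, fun t ht => ?_⟩
  · rw [agree t (ht.trans h01), hi t ht]
  · rcases le_or_gt s t₁ with h | h
    · rw [← G1 s h, P.Fset_congr R s (w' := hist u s)]
      · exact hg s ⟨hs.1, h⟩
      · intro τ hτ
        exact agree _ (by linarith)
    · rw [← G2 s h]
      exact hg' s ⟨h.le, hs.2⟩
  · rcases le_total t t₁ with h | h
    · exact eq1 t ⟨ht.1, h⟩
    · have hi1 : IntervalIntegrable G volume t₀ t₁ :=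
        (intervalIntegrable_iff_integrableOn_Icc_of_le h01).2 I1
      have hi2 : IntervalIntegrable G volume t₁ t :=
        (intervalIntegrable_iff_integrableOn_Icc_of_le h).2
          (I.mono_set (Icc_subset_Icc h01 ht.2))
      have e1 : ∫ s in t₁..t, g' s = ∫ s in t₁..t, G s := by
        rw [intervalIntegral.integral_of_le h, intervalIntegral.integral_of_le h]
        exact setIntegral_congr_fun measurableSet_Ioc fun s hs => G2 s hs.1
      have e2 : clampHist u t₁ 0 = u' t₁ := by
        rw [agree t₁ le_rfl]
        simp [clampHist]
      rw [← intervalIntegral.integral_add_adjacent_intervals hi1 hi2, ← add_assoc,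
        ← eq1 t₁ ⟨h01, le_rfl⟩, heq' t ⟨h, ht.2⟩, e1, e2]

theorem att_cocycle {t₀ t₁ t₂ : ℝ} (h01 : t₀ ≤ t₁) (h12 : t₁ ≤ t₂) {u₀ : ℝ → NState n}
    (hu₀ : ContinuousOn u₀ (Iic 0)) :
    P.att t₂ t₀ u₀ = ⋃ w ∈ P.att t₁ t₀ u₀, P.att t₂ t₁ w := by
  ext v
  simp only [mem_iUnion, exists_prop]
  constructor
  · rintro ⟨u, hu, rfl⟩
    obtain ⟨R, hR⟩ := exists_R hu.2.1
    have hT := P.tsol_of_sol (h01.trans h12) hu₀ hR hu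
    refine ⟨clampHist u t₁, ⟨u, P.sol_of_tsol (fun s hs => hR s ⟨hs.1, hs.2.trans h12⟩)
      (P.tsol_restrict h12 hT), rfl⟩, u, P.sol_of_tsol (fun s hs => hR s ⟨h01.trans hs.1, hs.2⟩)
      (P.tsol_shift h01 h12 hT), rfl⟩
  · rintro ⟨_, ⟨u, hu, rfl⟩, u', hu', rfl⟩
    obtain ⟨R1, hR1⟩ := exists_R hu.2.1
    obtain ⟨R2, hR2⟩ := exists_R hu'.2.1
    have hA : ∀ s ∈ Icc t₀ t₁, ‖u s‖ ≤ max R1 R2 := fun s hs => (hR1 s hs).trans (le_max_left _ _)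
    have hB : ∀ s ∈ Icc t₁ t₂, ‖u' s‖ ≤ max R1 R2 := fun s hs => (hR2 s hs).trans (le_max_right _ _)
    have hT := P.tsol_of_sol h01 hu₀ hA hu
    have hT' := P.tsol_of_sol h12 (cont_clamp hT.2.1) hB hu'
    refine ⟨u', P.sol_of_tsol (R := max R1 R2) (fun s hs => ?_) (P.tsol_glue h01 h12 hT hT'), rfl⟩
    rcases le_total s t₁ with h | h
    · have := hu'.1 (s - t₁) (by linarith)
      rw [add_sub_cancel] at this
      rw [this, clampHist, min_eq_left (by linarith), add_sub_cancel]
      exact hA s ⟨hs.1, h⟩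
    · exact hB s ⟨h, hs.2⟩

/-- Boundedness of the weighted norm of a history. -/
theorem bdd_clamp {γ t₀ t₁ : ℝ} (hγ : 0 < γ) (ht : t₀ ≤ t₁) {u₀ u : ℝ → NState n} (hu₀ : InC γ u₀)
    (hini : ∀ t ≤ t₀, u t = u₀ (t - t₀)) (hc : ContinuousOn u (Icc t₀ t₁)) :
    ∃ M, ∀ s ≤ 0, Real.exp (γ * s) * ‖clampHist u t₁ s‖ ≤ M := by
  obtain ⟨R, hR⟩ := exists_R hc
  obtain ⟨Q, hQ⟩ := hu₀.2.2
  have hQ' : ∀ s ≤ 0, Real.exp (γ * s) * ‖u₀ s‖ ≤ Q := fun s hs => hQ ⟨⟨s, hs⟩, rfl⟩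
  refine ⟨max R Q, fun s hs => ?_⟩
  simp only [clampHist]
  rw [min_eq_left hs]
  rcases le_total t₀ (t₁ + s) with h | h
  · have h1 := hR (t₁ + s) ⟨h, by linarith⟩
    have h2 : Real.exp (γ * s) ≤ 1 := Real.exp_le_one_iff.2 (mul_nonpos_of_nonneg_of_nonpos hγ.le hs)
    refine le_trans ?_ (h1.trans (le_max_left _ _))
    exact mul_le_of_le_one_left (norm_nonneg _) h2
  · rw [hini _ h]
    refine le_trans ?_ ((hQ' (t₁ + s - t₀) (by linarith)).trans (le_max_right _ _))
    refine mul_le_mul_of_nonneg_right (Real.exp_le_exp.2 ?_) (norm_nonneg _)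
    exact mul_le_mul_of_nonneg_left (by linarith) hγ.le

theorem att_closed {γ t₀ t₁ : ℝ} (hγ : 0 < γ) (ht : t₀ ≤ t₁) {u₀ v : ℝ → NState n} (hu₀ : InC γ u₀)
    (hv : InC γ v) (hvc : ∀ s ≥ (0 : ℝ), v s = v 0)
    (hlim : ∀ δ > (0 : ℝ), ∃ w ∈ P.att t₁ t₀ u₀, gNorm γ (fun s => v s - w s) < δ) :
    v ∈ P.att t₁ t₀ u₀ := by
  have ex : ∀ k : ℕ, ∃ u, P.Sol t₀ t₁ u₀ u ∧
      ∀ s ≤ 0, Real.exp (γ * s) * ‖v s - u (t₁ + s)‖ ≤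
        Real.exp (-(γ * (t₁ - t₀))) / ((k : ℝ) + 1) := by
    intro k
    obtain ⟨_, ⟨u, hu, rfl⟩, hw⟩ := hlim (Real.exp (-(γ * (t₁ - t₀))) / ((k : ℝ) + 1))
      (by positivity)
    refine ⟨u, hu, fun s hs => ?_⟩
    have hini : ∀ t ≤ t₀, u t = u₀ (t - t₀) := fun t h => by
      rw [← hu.1 (t - t₀) (by linarith)]
      congr 1
      ring
    obtain ⟨M, hM⟩ := bdd_clamp hγ ht hu₀ hini hu.2.1
    obtain ⟨Q, hQ⟩ := hv.2.2
    have hQ' : ∀ s ≤ 0, Real.exp (γ * s) * ‖v s‖ ≤ Q := fun s hs => hQ ⟨⟨s, hs⟩, rfl⟩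
    have bdd : BddAbove (range fun t : Iic (0 : ℝ) =>
        Real.exp (γ * t.1) * ‖v t.1 - clampHist u t₁ t.1‖) := by
      refine ⟨Q + M, ?_⟩
      rintro _ ⟨⟨t, ht'⟩, rfl⟩
      have h1 := hQ' t ht'
      have h2 := hM t ht'
      have h3 := mul_le_mul_of_nonneg_left (norm_sub_le (v t) (clampHist u t₁ t))
        (Real.exp_pos (γ * t)).le
      simp only
      linarith
    have h1 := le_ciSup bdd ⟨s, hs⟩
    simp only [clampHist] at h1
    rw [min_eq_left hs] at h1
    exact h1.trans hw.le
  choose uk hsol hb using ex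
  set u : ℝ → NState n := fun t => v (t - t₁) with hu
  have hb' : ∀ k, ∀ t ≤ t₁, ‖u t - uk k t‖ ≤
      Real.exp (-(γ * (t - t₁))) * (Real.exp (-(γ * (t₁ - t₀))) / ((k : ℝ) + 1)) := by
    intro k t ht'
    have h1 := hb k (t - t₁) (by linarith)
    rw [add_sub_cancel] at h1
    have h2 := mul_le_mul_of_nonneg_left h1 (Real.exp_pos (-(γ * (t - t₁)))).le
    rwa [← mul_assoc, ← Real.exp_add, neg_add_cancel, Real.exp_zero, one_mul] at h2
  have conv : ∀ t ≤ t₁, Tendsto (fun k => uk k t) atTop (𝓝 (u t)) := by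
    intro t ht'
    rw [tendsto_iff_norm_sub_tendsto_zero]
    refine squeeze_zero (fun _ => norm_nonneg _) (fun k =>
      (norm_sub_rev _ _).trans_le (hb' k t ht')) ?_
    have h0 : Tendsto (fun k : ℕ => (1 : ℝ) / ((k : ℝ) + 1)) atTop (𝓝 0) :=
      tendsto_one_div_add_atTop_nhds_zero_nat
    have := h0.const_mul (Real.exp (-(γ * (t - t₁))) * Real.exp (-(γ * (t₁ - t₀))))
    rw [mul_zero] at this
    refine this.congr fun k => ?_
    ring
  have hcu : ContinuousOn u (Iic t₁) := by
    refine hv.1.comp (f := fun t => t - t₁) (by fun_prop) fun s hs => ?_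
    have : s ≤ t₁ := hs
    exact mem_Iic.2 (by linarith)
  obtain ⟨R0, hR0⟩ := exists_R (hcu.mono (Icc_subset_Iic_self (a := t₀)))
  have hR : 0 ≤ R0 + 1 := by
    linarith [(norm_nonneg _).trans (hR0 t₀ ⟨le_rfl, ht⟩)]
  have hRk : ∀ k, ∀ s ∈ Icc t₀ t₁, ‖uk k s‖ ≤ R0 + 1 := by
    intro k s hs
    have h1 := hb' k s hs.2
    have h2 : Real.exp (-(γ * (s - t₁))) * (Real.exp (-(γ * (t₁ - t₀))) / ((k : ℝ) + 1)) ≤ 1 := by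
      rw [← mul_div_assoc, ← Real.exp_add, div_le_one (by positivity)]
      have h3 : Real.exp (-(γ * (s - t₁)) + -(γ * (t₁ - t₀))) ≤ 1 := by
        refine Real.exp_le_one_iff.2 ?_
        nlinarith [mul_nonneg hγ.le (sub_nonneg.2 hs.1)]
      have : (0 : ℝ) ≤ k := Nat.cast_nonneg k
      linarith
    have h4 : ‖uk k s‖ ≤ ‖u s‖ + ‖u s - uk k s‖ := by
      rw [norm_sub_rev]
      exact norm_le_norm_add_norm_sub' _ _
    linarith [hR0 s hs]
  have hT : ∀ k, P.TSol (R0 + 1) t₀ t₁ u₀ (uk k) := fun k =>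
    P.tsol_of_sol ht hu₀.1 (hRk k) (hsol k)
  choose hini hcuk f hf hmem heq using hT
  have initu : ∀ t ≤ t₀, u t = u₀ (t - t₀) := fun t ht' => by
    refine tendsto_nhds_unique (conv t (ht'.trans ht)) ?_
    simp only [hini _ t ht']
    exact tendsto_const_nhds
  obtain ⟨h1, h2⟩ := P.closure_lemma (h := fun _ => 0) hR ht (fun _ => le_rfl) tendsto_const_nhds
    hu₀.1 hini initu hcuk hf heq (by simpa only [sub_zero] using hmem) (fun t h => conv t h.2)
  refine ⟨u, P.sol_of_tsol (R := R0 + 1) (fun s hs => by linarith [hR0 s hs]) ⟨initu, h1, h2⟩, ?_⟩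
  funext s
  simp only [clampHist, hu, add_sub_cancel_left]
  rcases le_total s 0 with h | h
  · rw [min_eq_left h]
  · rw [min_eq_right h, hvc s h]

end Dat

/-- the attainability sets of the `ε`-inflated inclusion define a
set-valued process on `C_γ`: (i) initial value property, (ii) cocycle (two-parameter
semigroup) property, (iii) values are nonempty closed subsets of `C_γ`
(closedness formulated metrically with respect to `‖·‖_γ`). -/
theorem stmt14 {n : ℕ} (hn : 2 ≤ n) (γ α : ℝ) (hγ : 0 < γ)
    (A : Fin n → ℝ → ℝ) (B : IdxZ n → ℝ → ℝ) (μ : IdxZ n → Measure ℝ)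
    (c d : IdxZ n → ℝ) (Γ : Fin n → ℝ) (Istim : Fin n → ℝ → ℝ)
    (hD : HypD α A B) (hM : HypM γ μ) (hI : HypI Istim)
    (hc : ∀ p, 0 ≤ c p) (hd : ∀ p, 0 ≤ d p)
    (ε : ℝ) (hε : ε ∈ Icc (0 : ℝ) (1 / 5)) :
    (∀ t₀ : ℝ, ∀ u₀ : ℝ → NState n, InC γ u₀ → (∀ s ≥ (0 : ℝ), u₀ s = u₀ 0) →
      attain ε A B μ c d Γ Istim t₀ t₀ u₀ = {u₀}) ∧
    (∀ t₀ t₁ t₂ : ℝ, t₀ ≤ t₁ → t₁ ≤ t₂ →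
      ∀ u₀ : ℝ → NState n, InC γ u₀ → (∀ s ≥ (0 : ℝ), u₀ s = u₀ 0) →
      attain ε A B μ c d Γ Istim t₂ t₀ u₀ =
        ⋃ w ∈ attain ε A B μ c d Γ Istim t₁ t₀ u₀,
          attain ε A B μ c d Γ Istim t₂ t₁ w) ∧
    (∀ t₀ t₁ : ℝ, t₀ ≤ t₁ →
      ∀ u₀ : ℝ → NState n, InC γ u₀ → (∀ s ≥ (0 : ℝ), u₀ s = u₀ 0) →
      (attain ε A B μ c d Γ Istim t₁ t₀ u₀).Nonempty ∧
      ∀ v : ℝ → NState n, InC γ v → (∀ s ≥ (0 : ℝ), v s = v 0) →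
        (∀ δ > (0 : ℝ), ∃ w ∈ attain ε A B μ c d Γ Istim t₁ t₀ u₀,
          gNorm γ (fun s => v s - w s) < δ) →
        v ∈ attain ε A B μ c d Γ Istim t₁ t₀ u₀) := by
  have hμ : ∀ p, μ p (Iic 0) < ⊤ := by
    intro p
    refine lt_of_le_of_lt ?_ (hM p)
    rw [← setLIntegral_one]
    refine setLIntegral_mono' measurableSet_Iic fun t ht => ?_
    rw [← ENNReal.ofReal_one]
    refine ENNReal.ofReal_le_ofReal (Real.one_le_exp ?_)
    have : t ≤ 0 := ht
    nlinarith
  let P : Dat n :=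
    { ε := ε, A := A, B := B, μ := μ, c := c, d := d, Γ := Γ, Istim := Istim
      hA := fun i => (hD.2.1 i).1.continuous
      hA0 := fun i s => hD.1.le.trans ((hD.2.1 i).2 s)
      hB := fun i => (hD.2.2 i).1.continuous
      hB0 := fun i s => hD.1.le.trans ((hD.2.2 i).2 s)
      hμ := hμ
      hI := hI
      hb := bfun_nonneg hε
      h0 := hε.1
      h1 := by linarith [hε.2] }
  refine ⟨fun t₀ u₀ hu₀ hcl => P.att_self hu₀.1 hcl,
    fun t₀ t₁ t₂ h01 h12 u₀ hu₀ _ => P.att_cocycle h01 h12 hu₀.1,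
    fun t₀ t₁ ht u₀ hu₀ _ => ⟨P.att_nonempty ht hu₀.1, fun v hv hvc hlim =>
      P.att_closed hγ ht hu₀ hv hvc hlim⟩⟩

end
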